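/- Let m ≥ 2 and let v be a vector field smooth on a neighborhood of the closed unit ball B̄ ⊂ ℝ^m. Then there exist functions f and h and a vector field w, all smooth on B̄, such that v_i = ∂_i f + ∂_i h + w_i on B̄ for all i, where f(x) = 0 for all x ∈ S, Δh = 0 on B̄, div w = 0 on B̄, and ∑_k w_k(x) x_k = 0 for all x ∈ S. Moreover this decomposition is unique in the following sense: if f, h, w satisfy these side conditions and ∂_i f + ∂_i h + w_i = 0 on B̄ for all i, then f = 0 on B̄, h is constant on B̄, and w = 0 on B̄; consequently the three one-forms ∇f, ∇h, w are uniquely determined by v (and f is unique, h unique up to an additive constant). (This is the paper's one-form decomposition v = d(vᵗ + vʰ) + vⁿ into a gradient vanishing on the boundary, a harmonic gradient, and a divergence-free tangential part, specialized to the flat ball.) -/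

import Mathlib

/-!
STATEMENT 9: The paper's one-form decomposition v = d(vᵗ + vʰ) + vⁿ,
specialized to the closed unit ball: any smooth vector field decomposes as a
gradient vanishing on the boundary, a harmonic gradient, and a divergence-free
tangential part; with the corresponding uniqueness statement.
-/

noncomputable section

/-- Euclidean space ℝ^m. -/
abbrev E (m : ℕ) := EuclideanSpace ℝ (Fin m)

/-- The closed unit ball B̄ ⊆ ℝ^m. -/
def Ball (m : ℕ) : Set (E m) := Metric.closedBall 0 1

/-- The unit sphere S = ∂B̄ ⊆ ℝ^m. -/
def Sph (m : ℕ) : Set (E m) := Metric.sphere 0 1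

/-- The i-th partial derivative (taken within the closed unit ball). -/
def pd {m : ℕ} (i : Fin m) (f : E m → ℝ) : E m → ℝ :=
  fun x => fderivWithin ℝ f (Ball m) x (EuclideanSpace.single i 1)

/-- The Euclidean Laplacian Δf = ∑ i, ∂_i ∂_i f. -/
def lap {m : ℕ} (f : E m → ℝ) : E m → ℝ :=
  fun x => ∑ i, pd i (pd i f) x

open MvPolynomial in
/-- Laplacian on polynomials. -/
def pLap {m : ℕ} (p : MvPolynomial (Fin m) ℝ) : MvPolynomial (Fin m) ℝ :=
  ∑ i, pderiv i (pderiv i p)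

open MvPolynomial in
/-- Euler operator. -/
def eul (m : ℕ) : Derivation ℝ (MvPolynomial (Fin m) ℝ) (MvPolynomial (Fin m) ℝ) :=
  ∑ i, (X i : MvPolynomial (Fin m) ℝ) • pderiv i

open MvPolynomial in
/-- Rotation operator. -/
def rot {m : ℕ} (i j : Fin m) :
    Derivation ℝ (MvPolynomial (Fin m) ℝ) (MvPolynomial (Fin m) ℝ) :=
  (X i : MvPolynomial (Fin m) ℝ) • pderiv j - (X j : MvPolynomial (Fin m) ℝ) • pderiv i

open MvPolynomial in
/-- Square of the norm. -/
def rho (m : ℕ) : MvPolynomial (Fin m) ℝ := ∑ i, X i * X i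

section algebra
open MvPolynomial

variable {m : ℕ}

lemma eul_apply (p : MvPolynomial (Fin m) ℝ) : eul m p = ∑ i, X i * pderiv i p := by
  simp only [eul, ← Derivation.coeFnAddMonoidHom_apply, map_sum, Finset.sum_apply]
  rfl

lemma rot_apply (i j : Fin m) (p : MvPolynomial (Fin m) ℝ) :
    rot i j p = X i * pderiv j p - X j * pderiv i p := rfl

lemma pderiv_comm' (i j : Fin m) (p : MvPolynomial (Fin m) ℝ) :
    pderiv i (pderiv j p) = pderiv j (pderiv i p) := by
  have : ⁅(pderiv i : Derivation ℝ (MvPolynomial (Fin m) ℝ) (MvPolynomial (Fin m) ℝ)), (pderiv j :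
      Derivation ℝ (MvPolynomial (Fin m) ℝ) (MvPolynomial (Fin m) ℝ))⁆ = 0 := by
    apply MvPolynomial.derivation_ext
    intro k
    rw [Derivation.commutator_apply]
    simp only [pderiv_X, Pi.single_apply]
    split_ifs <;> simp
  have h := congrArg (fun d => d p) this
  simp only [Derivation.commutator_apply, Derivation.coe_zero, Pi.zero_apply] at h
  exact sub_eq_zero.mp h

lemma pLap_add (p q : MvPolynomial (Fin m) ℝ) : pLap (p + q) = pLap p + pLap q := by
  simp [pLap, Finset.sum_add_distrib]

lemma pLap_smul (c : ℝ) (p : MvPolynomial (Fin m) ℝ) : pLap (c • p) = c • pLap p := by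
  simp [pLap, Finset.smul_sum]

lemma pLap_neg (p : MvPolynomial (Fin m) ℝ) : pLap (-p) = - pLap p := by
  simp [pLap]

lemma pLap_sub (p q : MvPolynomial (Fin m) ℝ) : pLap (p - q) = pLap p - pLap q := by
  simp [pLap]

lemma pLap_sum {ι : Type*} (s : Finset ι) (p : ι → MvPolynomial (Fin m) ℝ) :
    pLap (∑ k ∈ s, p k) = ∑ k ∈ s, pLap (p k) := by
  simp only [pLap, map_sum]
  rw [Finset.sum_comm]

lemma pLap_X_mul (i : Fin m) (q : MvPolynomial (Fin m) ℝ) :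
    pLap (X i * q) = X i * pLap q + 2 * pderiv i q := by
  have h : ∀ k, pderiv k (pderiv k (X i * q)) =
      X i * pderiv k (pderiv k q) + (if k = i then 2 * pderiv i q else 0) := by
    intro k
    by_cases hk : k = i
    · subst hk; simp; ring
    · simp [pderiv_X_of_ne (Ne.symm hk), hk]
  simp only [pLap, h, Finset.sum_add_distrib, Finset.mul_sum]
  simp

lemma pLap_pderiv (i : Fin m) (p : MvPolynomial (Fin m) ℝ) :
    pLap (pderiv i p) = pderiv i (pLap p) := by
  simp only [pLap, map_sum]
  refine Finset.sum_congr rfl fun k _ => ?_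
  rw [pderiv_comm' k i, pderiv_comm' k i]

lemma pLap_eul (p : MvPolynomial (Fin m) ℝ) : pLap (eul m p) = eul m (pLap p) + 2 * pLap p := by
  rw [eul_apply, eul_apply, pLap_sum]
  simp only [pLap_X_mul, Finset.sum_add_distrib, pLap_pderiv]
  congr 1
  simp [pLap, Finset.mul_sum]

lemma pLap_rot (i j : Fin m) (p : MvPolynomial (Fin m) ℝ) :
    pLap (rot i j p) = rot i j (pLap p) := by
  rw [rot_apply, rot_apply, pLap_sub, pLap_X_mul, pLap_X_mul, pLap_pderiv, pLap_pderiv,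
    pderiv_comm' j i]
  ring

lemma eul_X (i : Fin m) : eul m (X i) = X i := by
  rw [eul_apply]
  simp [pderiv_X, Pi.single_apply]

lemma eul_rot (i j : Fin m) (p : MvPolynomial (Fin m) ℝ) :
    eul m (rot i j p) = rot i j (eul m p) := by
  have : ⁅eul m, rot i j⁆ = 0 := by
    apply MvPolynomial.derivation_ext
    intro k
    rw [Derivation.commutator_apply, eul_X, rot_apply]
    simp only [pderiv_X, Pi.single_apply]
    split_ifs <;> simp [eul_X]
  have h := congrArg (fun d => d p) this
  simp only [Derivation.commutator_apply, Derivation.coe_zero, Pi.zero_apply] at h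
  exact sub_eq_zero.mp h

lemma eul_pderiv (i : Fin m) (p : MvPolynomial (Fin m) ℝ) :
    eul m (pderiv i p) + pderiv i p = pderiv i (eul m p) := by
  have h : ∀ k, pderiv i (X k * pderiv k p) =
      X k * pderiv k (pderiv i p) + (if k = i then pderiv i p else 0) := by
    intro k
    by_cases hk : k = i
    · subst hk; simp
    · simp [pderiv_X_of_ne hk, hk, pderiv_comm' i k]
  rw [eul_apply, eul_apply, map_sum]
  simp only [h, Finset.sum_add_distrib]
  simp

lemma eul_rho : eul m (rho m) = 2 * rho m := by
  simp only [rho, map_sum, Derivation.leibniz, eul_X, smul_eq_mul, Finset.mul_sum]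
  exact Finset.sum_congr rfl fun _ _ => by ring

lemma pderiv_rho (i : Fin m) : pderiv i (rho m) = 2 * X i := by
  simp only [rho, map_sum, Derivation.leibniz, smul_eq_mul]
  rw [Finset.sum_eq_single i]
  · simp; ring
  · intro b _ hb
    simp [pderiv_X_of_ne hb]
  · simp

lemma rot_rho (i j : Fin m) : rot i j (rho m) = 0 := by
  rw [rot_apply, pderiv_rho, pderiv_rho]; ring

lemma rho_mul_pderiv (i : Fin m) (p : MvPolynomial (Fin m) ℝ) :
    rho m * pderiv i p = X i * eul m p + ∑ j, X j * rot j i p := by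
  simp only [rot_apply, mul_sub, Finset.sum_sub_distrib, rho, Finset.sum_mul, eul_apply,
    Finset.mul_sum]
  have : ∀ k, X k * (X i * pderiv k p) = X i * (X k * pderiv k p) := fun k => by ring
  simp only [this, mul_assoc]
  ring

lemma eul_eul (p : MvPolynomial (Fin m) ℝ) :
    eul m (eul m p) = eul m p + ∑ i, ∑ j, X i * X j * pderiv i (pderiv j p) := by
  rw [eul_apply p, map_sum]
  simp only [Derivation.leibniz, eul_X, smul_eq_mul, Finset.sum_add_distrib]
  rw [add_comm]
  congr 1
  · simp only [mul_comm]
  · simp only [eul_apply, Finset.mul_sum]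
    refine Finset.sum_congr rfl fun i _ => Finset.sum_congr rfl fun j _ => ?_
    rw [pderiv_comm']; ring

lemma rot_rot (i j : Fin m) (p : MvPolynomial (Fin m) ℝ) :
    rot i j (rot i j p) = (X i * X i * pderiv j (pderiv j p) + X j * X j * pderiv i (pderiv i p))
      - 2 * (X i * X j * pderiv i (pderiv j p)) - (X i * pderiv i p + X j * pderiv j p)
      + (if i = j then 2 * (X i * pderiv i p) else 0) := by
  by_cases h : i = j
  · subst h; simp [rot_apply]; ring
  · simp only [rot_apply, map_sub, Derivation.leibniz, pderiv_X_self,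
      pderiv_X_of_ne h, pderiv_X_of_ne (Ne.symm h), smul_eq_mul, h, if_false]
    rw [pderiv_comm' j i]; ring

lemma key_identity (p : MvPolynomial (Fin m) ℝ) :
    2 * eul m (eul m p) + ∑ i, ∑ j, rot i j (rot i j p)
      = 2 * (rho m * pLap p) + (4 - 2 * (m : MvPolynomial (Fin m) ℝ)) * eul m p := by
  simp only [rot_rot, Finset.sum_add_distrib, Finset.sum_sub_distrib, eul_eul]
  have h1 : ∑ i : Fin m, ∑ j : Fin m, X i * X i * pderiv j (pderiv j p) = rho m * pLap p := by
    simp only [rho, pLap, Finset.sum_mul, Finset.mul_sum]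
    exact Finset.sum_comm
  have h2 : ∑ i : Fin m, ∑ j : Fin m, X j * X j * pderiv i (pderiv i p) = rho m * pLap p := by
    rw [Finset.sum_comm, h1]
  have h3 : ∑ i : Fin m, ∑ j : Fin m, X i * pderiv i p = (m : MvPolynomial (Fin m) ℝ) * eul m p := by
    simp [eul_apply, Finset.mul_sum]
  have h4 : ∑ i : Fin m, ∑ j : Fin m, X j * pderiv j p = (m : MvPolynomial (Fin m) ℝ) * eul m p := by
    simp [eul_apply]
  have h5 : ∑ i : Fin m, ∑ j : Fin m, (if i = j then 2 * (X i * pderiv i p) else 0)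
      = 2 * eul m p := by
    simp [eul_apply, Finset.mul_sum]
  rw [h1, h2, h3, h4, h5]
  simp only [← Finset.mul_sum]
  ring

end algebra

section analysis
open MvPolynomial Topology Filter

variable {m : ℕ}

/-- Evaluation of a polynomial at a point of Euclidean space. -/
def ev (p : MvPolynomial (Fin m) ℝ) (x : E m) : ℝ := MvPolynomial.eval (fun i => x i) p

@[simp] lemma ev_add (p q : MvPolynomial (Fin m) ℝ) (x : E m) : ev (p + q) x = ev p x + ev q x := by
  simp [ev]
@[simp] lemma ev_sub (p q : MvPolynomial (Fin m) ℝ) (x : E m) : ev (p - q) x = ev p x - ev q x := by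
  simp [ev]
@[simp] lemma ev_neg (p : MvPolynomial (Fin m) ℝ) (x : E m) : ev (-p) x = - ev p x := by
  simp [ev]
@[simp] lemma ev_mul (p q : MvPolynomial (Fin m) ℝ) (x : E m) : ev (p * q) x = ev p x * ev q x := by
  simp [ev]
@[simp] lemma ev_smul (c : ℝ) (q : MvPolynomial (Fin m) ℝ) (x : E m) : ev (c • q) x = c * ev q x := by
  simp [ev]
@[simp] lemma ev_C (c : ℝ) (x : E m) : ev (C c) x = c := by simp [ev]
@[simp] lemma ev_one (x : E m) : ev 1 x = 1 := by simp [ev]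
@[simp] lemma ev_zero (x : E m) : ev 0 x = 0 := by simp [ev]
@[simp] lemma ev_X (i : Fin m) (x : E m) : ev (X i) x = x i := by simp [ev]
@[simp] lemma ev_two (x : E m) : ev (2 : MvPolynomial (Fin m) ℝ) x = 2 := by
  have h2 : (2 : MvPolynomial (Fin m) ℝ) = C 2 := (map_ofNat C 2).symm
  rw [h2, ev_C]
@[simp] lemma ev_natCast (n : ℕ) (x : E m) :
    ev (n : MvPolynomial (Fin m) ℝ) x = n := by simp [ev]
@[simp] lemma ev_sum {ι : Type*} (s : Finset ι) (p : ι → MvPolynomial (Fin m) ℝ) (x : E m) :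
    ev (∑ k ∈ s, p k) x = ∑ k ∈ s, ev (p k) x := by
  simp [ev]

lemma ev_rho (x : E m) : ev (rho m) x = ‖x‖ ^ 2 := by
  rw [EuclideanSpace.real_norm_sq_eq]
  simp [rho, pow_two]

lemma mem_Ball {x : E m} : x ∈ Ball m ↔ ‖x‖ ≤ 1 := by simp [Ball]
lemma mem_Sph {x : E m} : x ∈ Sph m ↔ ‖x‖ = 1 := by simp [Sph]
lemma Sph_sub_Ball {x : E m} (h : x ∈ Sph m) : x ∈ Ball m := mem_Ball.2 (mem_Sph.1 h).le

lemma Ball_ud : UniqueDiffOn ℝ (Ball m) := by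
  apply uniqueDiffOn_convex (convex_closedBall _ _)
  rw [interior_closedBall _ one_ne_zero]
  exact ⟨0, by simp⟩

lemma Ball_closure : closure (interior (Ball m)) = Ball m := by
  rw [Ball, interior_closedBall _ one_ne_zero, closure_ball _ one_ne_zero]

lemma Ball_nhds {x : E m} (h : ‖x‖ < 1) : Ball m ∈ 𝓝 x := by
  apply Metric.closedBall_mem_nhds_of_mem; simpa using h

lemma Ball_compact : IsCompact (Ball m) := isCompact_closedBall _ _

/-- The derivative of a polynomial. -/
def evD (p : MvPolynomial (Fin m) ℝ) (x : E m) : E m →L[ℝ] ℝ :=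
  ∑ i, ev (pderiv i p) x • EuclideanSpace.proj i

lemma evD_apply (p : MvPolynomial (Fin m) ℝ) (x y : E m) :
    evD p x y = ∑ i, ev (pderiv i p) x * y i := by
  simp [evD]

lemma ev_hasFDerivAt (p : MvPolynomial (Fin m) ℝ) (x : E m) : HasFDerivAt (ev p) (evD p x) x := by
  induction p using MvPolynomial.induction_on with
  | C a =>
    have : (ev (C a) : E m → ℝ) = fun _ => a := by ext; simp
    rw [this]
    have h2 : evD (C a) x = 0 := by ext; simp [evD]
    rw [h2]; exact hasFDerivAt_const _ _
  | add p q hp hq =>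
    have : (ev (p + q) : E m → ℝ) = fun y => ev p y + ev q y := by ext; simp
    rw [this]
    convert! hp.add hq using 1
    simp [evD, add_smul, Finset.sum_add_distrib]
  | mul_X p i hp =>
    have : (ev (p * X i) : E m → ℝ) = fun y => ev p y * y i := by ext; simp
    rw [this]
    have hX : HasFDerivAt (fun y : E m => y i) (EuclideanSpace.proj i : E m →L[ℝ] ℝ) x :=
      (EuclideanSpace.proj i : E m →L[ℝ] ℝ).hasFDerivAt
    convert! hp.mul hX using 1
    ext y
    rw [evD_apply]
    simp only [Derivation.leibniz, smul_eq_mul, ev_add, ev_mul, ev_X, add_mul,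
      Finset.sum_add_distrib, add_apply, smul_apply, evD_apply,
      Finset.mul_sum, pderiv_X, PiLp.proj_apply]
    congr 1
    · rw [Finset.sum_eq_single i]
      · simp
      · intro b _ hb
        simp [Pi.single_apply, hb.symm]
      · simp
    · exact Finset.sum_congr rfl fun _ _ => by ring

lemma ev_continuous (p : MvPolynomial (Fin m) ℝ) : Continuous (ev p) :=
  continuous_iff_continuousAt.2 fun x => (ev_hasFDerivAt p x).continuousAt

lemma ev_contDiff (p : MvPolynomial (Fin m) ℝ) : ContDiff ℝ (⊤ : ℕ∞) (ev p) := by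
  induction p using MvPolynomial.induction_on with
  | C a =>
    have : (ev (C a) : E m → ℝ) = fun _ => a := by ext; simp
    rw [this]; exact contDiff_const
  | add p q hp hq =>
    have : (ev (p + q) : E m → ℝ) = fun y => ev p y + ev q y := by ext; simp
    rw [this]; exact hp.add hq
  | mul_X p i hp =>
    have : (ev (p * X i) : E m → ℝ) = fun y => ev p y * y i := by ext; simp
    rw [this]; exact hp.mul (EuclideanSpace.proj i : E m →L[ℝ] ℝ).contDiff

lemma pd_eq_of_hasFDerivWithinAt {f : E m → ℝ} {f' : E m →L[ℝ] ℝ} {x : E m} (hx : x ∈ Ball m)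
    (h : HasFDerivWithinAt f f' (Ball m) x) (i : Fin m) :
    pd i f x = f' (EuclideanSpace.single i 1) := by
  rw [pd, h.fderivWithin (Ball_ud x hx)]

lemma pd_ev (i : Fin m) (p : MvPolynomial (Fin m) ℝ) {x : E m} (hx : x ∈ Ball m) :
    pd i (ev p) x = ev (pderiv i p) x := by
  rw [pd_eq_of_hasFDerivWithinAt hx (ev_hasFDerivAt p x).hasFDerivWithinAt, evD_apply]
  simp

lemma pd_congr {f g : E m → ℝ} (h : ∀ x ∈ Ball m, f x = g x) (i : Fin m) {x : E m}
    (hx : x ∈ Ball m) : pd i f x = pd i g x := by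
  rw [pd, pd, fderivWithin_congr h (h x hx)]

lemma lap_ev (p : MvPolynomial (Fin m) ℝ) {x : E m} (hx : x ∈ Ball m) :
    lap (ev p) x = ev (pLap p) x := by
  simp only [lap, pLap, ev_sum]
  refine Finset.sum_congr rfl fun i _ => ?_
  rw [pd_congr (fun y hy => pd_ev i p hy) i hx, pd_ev i _ hx]

/-- Smooth up to the boundary. -/
def Sm (f : E m → ℝ) : Prop := ContDiffOn ℝ (⊤ : ℕ∞) f (Ball m)

lemma Sm.diff {f : E m → ℝ} (h : Sm f) {x : E m} (hx : x ∈ Ball m) :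
    HasFDerivWithinAt f (fderivWithin ℝ f (Ball m) x) (Ball m) x :=
  (h.differentiableOn (by simp) x hx).hasFDerivWithinAt

lemma Sm.pd {f : E m → ℝ} (h : Sm f) (i : Fin m) : Sm (pd i f) := by
  have := ((contDiffOn_infty_iff_fderivWithin Ball_ud).1 h).2
  exact this.clm_apply contDiffOn_const

lemma ev_Sm (p : MvPolynomial (Fin m) ℝ) : Sm (ev p) := (ev_contDiff p).contDiffOn

lemma Sm.add {f g : E m → ℝ} (hf : Sm f) (hg : Sm g) : Sm (fun x => f x + g x) :=
  ContDiffOn.add hf hg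
lemma Sm.mul {f g : E m → ℝ} (hf : Sm f) (hg : Sm g) : Sm (fun x => f x * g x) :=
  ContDiffOn.mul hf hg
lemma Sm.neg {f : E m → ℝ} (hf : Sm f) : Sm (fun x => - f x) :=
  ContDiffOn.neg hf
lemma Sm.sum {ι : Type*} {s : Finset ι} {f : ι → E m → ℝ} (hf : ∀ i, Sm (f i)) :
    Sm (fun x => ∑ i ∈ s, f i x) :=
  ContDiffOn.sum fun i _ => hf i

lemma pd_add {f g : E m → ℝ} (hf : Sm f) (hg : Sm g) (i : Fin m) {x : E m} (hx : x ∈ Ball m) :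
    pd i (fun x => f x + g x) x = pd i f x + pd i g x :=
  pd_eq_of_hasFDerivWithinAt hx ((hf.diff hx).add (hg.diff hx)) i

lemma pd_neg {f : E m → ℝ} (hf : Sm f) (i : Fin m) {x : E m} (hx : x ∈ Ball m) :
    pd i (fun x => - f x) x = - pd i f x :=
  pd_eq_of_hasFDerivWithinAt hx ((hf.diff hx).neg) i

lemma pd_sum {ι : Type*} {s : Finset ι} {f : ι → E m → ℝ} (hf : ∀ i, Sm (f i))
    (i : Fin m) {x : E m} (hx : x ∈ Ball m) :
    pd i (fun x => ∑ k ∈ s, f k x) x = ∑ k ∈ s, pd i (f k) x := by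
  rw [pd_eq_of_hasFDerivWithinAt hx (HasFDerivWithinAt.fun_sum fun k _ => (hf k).diff hx) i]
  simp [pd]

lemma pd_mul {f g : E m → ℝ} (hf : Sm f) (hg : Sm g) (i : Fin m) {x : E m} (hx : x ∈ Ball m) :
    pd i (fun x => f x * g x) x = f x * pd i g x + g x * pd i f x := by
  rw [pd_eq_of_hasFDerivWithinAt hx (HasFDerivWithinAt.fun_mul (hf.diff hx) (hg.diff hx)) i]
  simp [pd]

lemma lap_add {f g : E m → ℝ} (hf : Sm f) (hg : Sm g) {x : E m} (hx : x ∈ Ball m) :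
    lap (fun x => f x + g x) x = lap f x + lap g x := by
  simp only [lap, ← Finset.sum_add_distrib]
  refine Finset.sum_congr rfl fun i _ => ?_
  rw [pd_congr (fun y hy => pd_add hf hg i hy) i hx, pd_add (hf.pd i) (hg.pd i) i hx]

lemma lap_neg {f : E m → ℝ} (hf : Sm f) {x : E m} (hx : x ∈ Ball m) :
    lap (fun x => - f x) x = - lap f x := by
  simp only [lap, ← Finset.sum_neg_distrib]
  refine Finset.sum_congr rfl fun i _ => ?_
  rw [pd_congr (fun y hy => pd_neg hf i hy) i hx, pd_neg (hf.pd i) i hx]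

lemma pd_comm {f : E m → ℝ} (hf : Sm f) (i j : Fin m) {x : E m} (hx : x ∈ Ball m) :
    pd i (pd j f) x = pd j (pd i f) x := by
  have h2 := ((contDiffOn_infty_iff_fderivWithin Ball_ud).1 hf).2
  have h3 : ∀ i j : Fin m, pd i (pd j f) x =
      fderivWithin ℝ (fderivWithin ℝ f (Ball m)) (Ball m) x (EuclideanSpace.single i 1)
        (EuclideanSpace.single j 1) := by
    intro i j
    have h4 : HasFDerivWithinAt (pd j f) _ (Ball m) x :=
      ((h2.differentiableOn (by simp) x hx).hasFDerivWithinAt).clm_apply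
        (hasFDerivWithinAt_const (EuclideanSpace.single j (1 : ℝ)) x (Ball m))
    rw [pd_eq_of_hasFDerivWithinAt hx h4]
    simp
  rw [h3, h3]
  refine ContDiffWithinAt.isSymmSndFDerivWithinAt (n := (⊤ : ℕ∞)) (hf x hx) ?_ Ball_ud ?_ hx _ _
  · simp only [minSmoothness_of_isRCLikeNormedField]
    exact WithTop.coe_le_coe.2 (le_top : (2 : ℕ∞) ≤ ⊤)
  · rw [Ball_closure]; exact hx

lemma line_deriv {f : E m → ℝ} (hf : Sm f) (i : Fin m) (x : E m) (t : ℝ)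
    (hx : ‖x + t • EuclideanSpace.single i (1 : ℝ)‖ < 1) :
    HasDerivAt (fun s : ℝ => f (x + s • EuclideanSpace.single i (1 : ℝ)))
      (pd i f (x + t • EuclideanSpace.single i (1 : ℝ))) t := by
  have h1 := (hf.diff (mem_Ball.2 hx.le)).hasFDerivAt (Ball_nhds hx)
  have h2 : HasDerivAt (fun s : ℝ => x + s • EuclideanSpace.single i (1 : ℝ))
      (EuclideanSpace.single i (1 : ℝ)) t := by
    simpa using ((hasDerivAt_id t).smul_const (EuclideanSpace.single i (1 : ℝ))).const_add x
  exact h1.comp_hasDerivAt t h2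

lemma max_strict {f : E m → ℝ} (hf : Sm f) {M : ℝ} (hS : ∀ x ∈ Sph m, f x ≤ M)
    (hL : ∀ x ∈ Ball m, 0 < lap f x) : ∀ x ∈ Ball m, f x ≤ M := by
  obtain ⟨x₀, hx₀, hmax⟩ := Ball_compact.exists_isMaxOn ⟨(0 : E m), by simp [mem_Ball]⟩
    hf.continuousOn
  intro x hx
  refine (hmax hx).trans ?_
  rcases (mem_Ball.1 hx₀).eq_or_lt with h1 | h1
  · exact hS _ (mem_Sph.2 h1)
  exfalso
  have hpos := hL x₀ hx₀
  obtain ⟨i, -, hi⟩ : ∃ i ∈ Finset.univ, 0 < pd i (pd i f) x₀ := by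
    by_contra! hcon
    exact absurd hpos (not_lt.2 (Finset.sum_nonpos hcon))
  set e := EuclideanSpace.single i (1 : ℝ) with he
  let g : ℝ → ℝ := fun s => f (x₀ + s • e)
  have hcont : Continuous fun s : ℝ => ‖x₀ + s • e‖ := by fun_prop
  have hev : ∀ᶠ s in 𝓝 (0 : ℝ), ‖x₀ + s • e‖ < 1 := by
    apply hcont.continuousAt.eventually_lt continuousAt_const
    simpa using h1
  have hd : ∀ᶠ s in 𝓝 (0 : ℝ), deriv g s = pd i f (x₀ + s • e) :=
    hev.mono fun s hs => (line_deriv hf i x₀ s hs).deriv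
  have hdd : deriv (deriv g) 0 = pd i (pd i f) x₀ := by
    rw [Filter.EventuallyEq.deriv_eq hd]
    have := (line_deriv (hf.pd i) i x₀ 0 (by simpa using h1)).deriv
    simpa using this
  have hlm : IsLocalMax g 0 := by
    filter_upwards [hev] with s hs
    simp only [g, zero_smul, add_zero]
    exact hmax (mem_Ball.2 hs.le)
  have hlmin : IsLocalMin g 0 := by
    apply isLocalMin_of_deriv_deriv_pos
    · rw [hdd]; exact hi
    · exact hlm.deriv_eq_zero
    · exact (line_deriv hf i x₀ 0 (by simpa using h1)).continuousAt
  have hconst : g =ᶠ[𝓝 0] fun _ => g 0 := by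
    filter_upwards [hlm, hlmin] with s h1 h2
    exact le_antisymm h1 h2
  have : deriv (deriv g) 0 = 0 := by
    have h2 : deriv g =ᶠ[𝓝 0] fun _ => 0 := by
      have := hconst.deriv
      simpa using this
    rw [h2.deriv_eq]; simp
  rw [hdd] at this
  exact hi.ne' this

lemma pLap_rho : pLap (rho m) = 2 * (m : MvPolynomial (Fin m) ℝ) := by
  simp only [pLap, pderiv_rho]
  have : ∀ i : Fin m, pderiv i (2 * X i : MvPolynomial (Fin m) ℝ) = 2 := by
    intro i
    have h2 : (2 : MvPolynomial (Fin m) ℝ) = C 2 := (map_ofNat C 2).symm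
    rw [h2, pderiv_C_mul]; simp
  simp only [this]
  simp [mul_comm]

lemma max_quant (hm : 2 ≤ m) {f : E m → ℝ} (hf : Sm f) {A B : ℝ} (hB : 0 ≤ B)
    (hS : ∀ x ∈ Sph m, f x ≤ A)
    (hL : ∀ x ∈ Ball m, -B ≤ lap f x) : ∀ x ∈ Ball m, f x ≤ A + B * (1 - ‖x‖ ^ 2) := by
  intro x hx
  apply le_of_forall_pos_le_add
  intro ε hε
  have hm' : (2 : ℝ) ≤ m := by exact_mod_cast hm
  have := max_strict (M := A + (B + ε)) (hf.add (ev_Sm ((B + ε) • rho m))) ?_ ?_ x hx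
  · simp only [ev_smul, ev_rho] at this
    nlinarith [sq_nonneg ‖x‖]
  · intro y hy
    simp only [ev_smul, ev_rho, mem_Sph.1 hy]
    have := hS y hy
    linarith
  · intro y hy
    rw [lap_add hf (ev_Sm _) hy, lap_ev _ hy, pLap_smul, pLap_rho]
    simp
    have := hL y hy
    nlinarith

lemma max_abs (hm : 2 ≤ m) {f : E m → ℝ} (hf : Sm f) {A B : ℝ} (hB : 0 ≤ B)
    (hS : ∀ x ∈ Sph m, |f x| ≤ A)
    (hL : ∀ x ∈ Ball m, |lap f x| ≤ B) : ∀ x ∈ Ball m, |f x| ≤ A + B * (1 - ‖x‖ ^ 2) := by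
  intro x hx
  rw [abs_le]
  constructor
  · have := max_quant hm hf.neg hB (fun x hx => (neg_le_abs _).trans (hS x hx))
      (fun x hx => by rw [lap_neg hf hx]; linarith [le_abs_self (lap f x), hL x hx]) x hx
    linarith
  · exact max_quant hm hf hB (fun x hx => (le_abs_self _).trans (hS x hx))
      (fun x hx => by linarith [neg_abs_le (lap f x), hL x hx]) x hx

lemma ev_eul (p : MvPolynomial (Fin m) ℝ) (x : E m) : ev (eul m p) x = evD p x x := by
  rw [eul_apply, evD_apply]; simp [mul_comm]

lemma radial_nonneg {p : MvPolynomial (Fin m) ℝ} {x : E m} (hx : x ∈ Ball m)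
    (h : ∀ y ∈ Ball m, ev p y ≤ ev p x) : 0 ≤ ev (eul m p) x := by
  have h1 : IsLocalMaxOn (ev p) (Ball m) x := IsMaxOn.localize h
  have h2 := h1.hasFDerivWithinAt_nonpos (ev_hasFDerivAt p x).hasFDerivWithinAt (y := 0 - x)
    (sub_mem_posTangentConeAt_of_segment_subset
      ((convex_closedBall (0 : E m) 1).segment_subset hx (by simp)))
  rw [ev_eul]
  simpa using h2

lemma barrier (hm : 2 ≤ m) {p : MvPolynomial (Fin m) ℝ} {B : ℝ} (hB : 0 ≤ B)
    (hS : ∀ x ∈ Sph m, ev p x = 0) (hL : ∀ x ∈ Ball m, |ev (pLap p) x| ≤ B) :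
    ∀ x ∈ Sph m, |ev (eul m p) x| ≤ 2 * B := by
  have key : ∀ q : MvPolynomial (Fin m) ℝ, (∀ x ∈ Sph m, ev q x = 0) →
      (∀ x ∈ Ball m, |ev (pLap q) x| ≤ B) → ∀ x ∈ Sph m, - (2 * B) ≤ ev (eul m q) x := by
    intro q hS hL x hx
    have h1 := max_abs hm (ev_Sm q) (A := 0) hB (fun x hx => by simp [hS x hx])
      (fun x hx => by rw [lap_ev _ hx]; exact hL x hx)
    have h2 := radial_nonneg (p := q + B • rho m) (Sph_sub_Ball hx) (fun y hy => by
      have := (le_abs_self _).trans (h1 y hy)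
      simp only [ev_add, ev_smul, ev_rho, hS x hx, mem_Sph.1 hx]
      linarith)
    simp only [map_add, Derivation.map_smul, eul_rho, ev_add, ev_smul, ev_mul, ev_rho, ev_two,
      mem_Sph.1 hx] at h2
    linarith
  intro x hx
  rw [abs_le]
  refine ⟨key p hS hL x hx, ?_⟩
  have := key (-p) (fun x hx => by simp [hS x hx]) (fun x hx => by
    rw [pLap_neg, ev_neg, abs_neg]; exact hL x hx) x hx
  rw [map_neg, ev_neg] at this
  linarith

lemma eul_bound {p : MvPolynomial (Fin m) ℝ} {B c : ℝ} (hc : 1 ≤ c)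
    (h : ∀ x ∈ Ball m, |ev (eul m p) x + c * ev p x| ≤ B) : ∀ x ∈ Ball m, |ev p x| ≤ B := by
  have key : ∀ q : MvPolynomial (Fin m) ℝ,
      (∀ x ∈ Ball m, |ev (eul m q) x + c * ev q x| ≤ B) → ∀ x ∈ Ball m, ev q x ≤ B := by
    intro q h x hx
    obtain ⟨x₀, hx₀, hmax⟩ := Ball_compact.exists_isMaxOn ⟨(0 : E m), by simp [mem_Ball]⟩
      (ev_continuous q).continuousOn
    have h1 := radial_nonneg hx₀ (fun y hy => hmax hy)
    have h2 := (le_abs_self _).trans (h x₀ hx₀)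
    have h3 : 0 ≤ B := (abs_nonneg _).trans (h x₀ hx₀)
    refine (hmax hx).trans ?_
    by_contra! hlt
    nlinarith
  intro x hx
  rw [abs_le]
  refine ⟨?_, key p h x hx⟩
  have := key (-p) (fun x hx => by
    have := h x hx
    rw [map_neg, ev_neg, ev_neg, ← abs_neg]
    convert! this using 2; ring) x hx
  rw [ev_neg] at this
  linarith

end analysis

section existence
open MvPolynomial

variable {m : ℕ}

lemma eq_zero_of_ball (hm : 2 ≤ m) {p : MvPolynomial (Fin m) ℝ} (h : ∀ x ∈ Ball m, ev p x = 0) :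
    p = 0 := by
  have hm0 : (0 : ℝ) < m := by exact_mod_cast (by omega : 0 < m)
  have hm1 : (1 : ℝ) ≤ m := by exact_mod_cast (by omega : 1 ≤ m)
  apply MvPolynomial.funext_set (fun _ : Fin m => Set.Icc (0 : ℝ) (1 / m))
    (fun _ => Set.Icc_infinite (by positivity))
  intro x hx
  have := h (WithLp.toLp 2 x) ?_
  · simpa [ev] using this
  · rw [mem_Ball, ← sq_le_one_iff₀ (norm_nonneg _), EuclideanSpace.real_norm_sq_eq]
    calc ∑ i, x i ^ 2 ≤ ∑ i : Fin m, (1 / m : ℝ) := by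
          refine Finset.sum_le_sum fun i _ => ?_
          have h1 := hx i (Set.mem_univ i)
          have h2 : (1 / m : ℝ) ≤ 1 := by
            rw [div_le_one hm0]; exact hm1
          nlinarith [h1.1, h1.2]
      _ = 1 := by simp [hm0.ne']

lemma totalDegree_pderiv_le' (i : Fin m) (p : MvPolynomial (Fin m) ℝ) :
    (pderiv i p).totalDegree ≤ p.totalDegree - 1 := by
  conv_lhs => rw [p.as_sum, map_sum]
  refine totalDegree_finsetSum_le fun s hs => ?_
  rw [pderiv_monomial]
  by_cases h0 : s i = 0
  · simp [h0]
  refine (totalDegree_monomial_le _ _).trans ?_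
  have h1 := le_totalDegree hs
  have h2 : s = (s - Finsupp.single i 1) + Finsupp.single i 1 := by
    ext k
    by_cases hk : i = k
    · subst hk; simp; omega
    · simp [Finsupp.single_apply, hk]
  have h3 : s.sum (fun _ e => e) = (s - Finsupp.single i 1).sum (fun _ e => e) + 1 := by
    conv_lhs => rw [h2]
    rw [Finsupp.sum_add_index'] <;> simp
  have h4 : ((s - Finsupp.single i 1).sum fun _ => id) = (s - Finsupp.single i 1).sum (fun _ e => e) := rfl
  rw [h4]
  omega

lemma totalDegree_pLap_le (p : MvPolynomial (Fin m) ℝ) :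
    (pLap p).totalDegree ≤ p.totalDegree - 2 := by
  refine totalDegree_finsetSum_le fun i _ => ?_
  have h1 := totalDegree_pderiv_le' i p
  have h2 := totalDegree_pderiv_le' i (pderiv i p)
  omega

lemma pLap_iter_zero (n : ℕ) : ∀ p : MvPolynomial (Fin m) ℝ, p.totalDegree ≤ n →
    pLap^[n + 1] p = 0 := by
  induction n with
  | zero =>
    intro p hp
    rw [totalDegree_eq_zero_iff_eq_C.1 (Nat.le_zero.1 hp)]
    simp [pLap]
  | succ n ih =>
    intro p hp
    rw [Function.iterate_succ_apply]
    apply ih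
    have := totalDegree_pLap_le p
    omega

lemma pLap_iter_add (n : ℕ) : ∀ p q : MvPolynomial (Fin m) ℝ,
    pLap^[n] (p + q) = pLap^[n] p + pLap^[n] q := by
  induction n with
  | zero => intro p q; rfl
  | succ n ih => intro p q; simp only [Function.iterate_succ_apply, pLap_add, ih]

lemma pLap_iter_neg (n : ℕ) : ∀ p : MvPolynomial (Fin m) ℝ,
    pLap^[n] (-p) = - pLap^[n] p := by
  induction n with
  | zero => intro p; rfl
  | succ n ih => intro p; simp only [Function.iterate_succ_apply, pLap_neg, ih]

lemma dirichlet (hm : 2 ≤ m) (g : MvPolynomial (Fin m) ℝ) :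
    ∃ q : MvPolynomial (Fin m) ℝ, pLap ((1 - rho m) * q) = g := by
  set n := g.totalDegree
  have hr : (1 - rho m).totalDegree ≤ 2 := by
    refine (totalDegree_sub _ _).trans (max_le (by simp) ?_)
    refine totalDegree_finsetSum_le fun i _ => ?_
    refine (totalDegree_mul _ _).trans ?_
    simp
  let T : restrictTotalDegree (Fin m) ℝ n →ₗ[ℝ] restrictTotalDegree (Fin m) ℝ n :=
    { toFun := fun q => ⟨pLap ((1 - rho m) * q.1), by
        rw [mem_restrictTotalDegree]
        have h1 := (mem_restrictTotalDegree (Fin m) n q.1).1 q.2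
        have h2 := totalDegree_pLap_le ((1 - rho m) * q.1)
        have h3 := totalDegree_mul (1 - rho m) q.1
        omega⟩
      map_add' := fun p q => by
        ext1; simp [mul_add, pLap_add]
      map_smul' := fun c p => by
        ext1; simp [pLap_smul] }
  have hinj : Function.Injective T := by
    rw [injective_iff_map_eq_zero]
    intro q hq
    have hq' : pLap ((1 - rho m) * q.1) = 0 := congrArg Subtype.val hq
    have h0 : (1 - rho m) * q.1 = 0 := by
      apply eq_zero_of_ball hm
      intro x hx
      have := max_abs hm (ev_Sm ((1 - rho m) * q.1)) (A := 0) (B := 0) le_rfl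
        (fun y hy => by simp [ev_rho, mem_Sph.1 hy])
        (fun y hy => by rw [lap_ev _ hy, hq']; simp) x hx
      rw [zero_mul, add_zero] at this
      exact abs_nonpos_iff.1 this
    rcases mul_eq_zero.1 h0 with h | h
    · exfalso
      have := congrArg (fun p => ev p 0) h
      simp [ev_rho] at this
    · exact Subtype.ext h
  obtain ⟨q, hq⟩ := (LinearMap.injective_iff_surjective.1 hinj)
    ⟨g, (mem_restrictTotalDegree _ _ _).2 le_rfl⟩
  exact ⟨q.1, congrArg Subtype.val hq⟩

lemma exists_eul (u : MvPolynomial (Fin m) ℝ) :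
    ∃ h : MvPolynomial (Fin m) ℝ, eul m h = u - C (ev u 0) := by
  induction u using MvPolynomial.induction_on' with
  | monomial s a =>
    have h1 := (isHomogeneous_monomial (d := s) a rfl).sum_X_mul_pderiv
    rw [← eul_apply] at h1
    by_cases hn : s.degree = 0
    · have : s = 0 := (Finsupp.degree_eq_zero_iff s).1 hn
      subst this
      refine ⟨0, ?_⟩
      have : (monomial 0 a : MvPolynomial (Fin m) ℝ) = C a := rfl
      rw [this]; simp
    · have hn' : (s.degree : ℝ) ≠ 0 := by exact_mod_cast hn
      have h2 : ev (monomial s a) (0 : E m) = 0 := by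
        have := congrArg (fun p => ev p 0) h1
        rw [← Nat.cast_smul_eq_nsmul ℝ] at this
        simp only [ev_eul, map_zero, ev_smul] at this
        exact (mul_eq_zero.1 this.symm).resolve_left hn'
      refine ⟨(s.degree : ℝ)⁻¹ • monomial s a, ?_⟩
      rw [Derivation.map_smul, h1, h2, ← Nat.cast_smul_eq_nsmul ℝ, smul_smul, inv_mul_cancel₀ hn']
      simp
  | add p q hp hq =>
    obtain ⟨h, hh⟩ := hp
    obtain ⟨h', hh'⟩ := hq
    refine ⟨h + h', ?_⟩
    rw [map_add, hh, hh', ev_add, map_add]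
    ring

lemma pLap_rho_mul (q : MvPolynomial (Fin m) ℝ) :
    pLap (rho m * q) = rho m * pLap q + (4 : ℝ) • eul m q + (2 * m : ℝ) • q := by
  have h2 : (2 : MvPolynomial (Fin m) ℝ) = C 2 := (map_ofNat C 2).symm
  have h : ∀ i : Fin m, pLap (X i * X i * q) =
      X i * X i * pLap q + (4 : ℝ) • (X i * pderiv i q) + (2 : ℝ) • q := by
    intro i
    rw [mul_assoc, pLap_X_mul, pLap_X_mul, Derivation.leibniz, pderiv_X_self]
    simp only [smul_eq_C_mul, h2, smul_eq_mul]
    have h4 : (C 4 : MvPolynomial (Fin m) ℝ) = C 2 + C 2 := by rw [← C_add]; norm_num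
    rw [h4]
    ring
  rw [rho, Finset.sum_mul, pLap_sum]
  simp only [h, Finset.sum_add_distrib, eul_apply, Finset.smul_sum, Finset.sum_mul]
  congr 1
  simp only [Finset.sum_const, Finset.card_univ, Fintype.card_fin]
  rw [← Nat.cast_smul_eq_nsmul ℝ, smul_smul, mul_comm]

lemma pLap_iter_rho_mul (q : MvPolynomial (Fin m) ℝ) (j : ℕ) :
    pLap^[j + 1] (rho m * q) = rho m * pLap^[j + 1] q + (4 * (j + 1) : ℝ) • eul m (pLap^[j] q)
      + (2 * (j + 1) * (m + 2 * j) : ℝ) • pLap^[j] q := by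
  induction j with
  | zero => simp [pLap_rho_mul]
  | succ j ih =>
    rw [Function.iterate_succ_apply', ih, pLap_add, pLap_add, pLap_smul, pLap_smul, pLap_eul,
      pLap_rho_mul]
    simp only [← Function.iterate_succ_apply' pLap]
    simp only [Function.iterate_succ_apply' pLap (j + 1)]
    have h2 : (2 : MvPolynomial (Fin m) ℝ) = C 2 := (map_ofNat C 2).symm
    rw [h2, ← smul_eq_C_mul]
    push_cast
    module

lemma compat (hm : 2 ≤ m) (w : Fin m → MvPolynomial (Fin m) ℝ) (q : MvPolynomial (Fin m) ℝ)
    (hw : ∑ i, pderiv i (w i) = 0) (hu : pLap (∑ i, X i * w i + (1 - rho m) * q) = 0) :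
    ev (∑ i, X i * w i + (1 - rho m) * q) 0 = 0 := by
  have h1 : ∀ j : ℕ, ∀ w : Fin m → MvPolynomial (Fin m) ℝ, ∑ i, pderiv i (w i) = 0 →
      ev (pLap^[j] (∑ i, X i * w i)) 0 = 0 := by
    intro j
    induction j with
    | zero => intro w _; simp
    | succ j ih =>
      intro w hw
      rw [Function.iterate_succ_apply]
      have : pLap (∑ i, X i * w i) = ∑ i, X i * pLap (w i) := by
        rw [pLap_sum]
        simp only [pLap_X_mul, Finset.sum_add_distrib, ← Finset.mul_sum, hw]
        simp
      rw [this]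
      apply ih
      simp only [← pLap_pderiv, ← pLap_sum, hw]
      simp [pLap]
  have heul : ∀ p : MvPolynomial (Fin m) ℝ, ev (eul m p) 0 = 0 := by
    intro p; rw [eul_apply]; simp
  have hrho : ev (rho m) 0 = 0 := by simp [ev_rho]
  have e : ∑ i, X i * w i + (1 - rho m) * q = ∑ i, X i * w i + q + -(rho m * q) := by ring
  have h2 : ∀ j : ℕ, ev (pLap^[j + 1] q) 0 = (2 * (j + 1) * (m + 2 * j) : ℝ) * ev (pLap^[j] q) 0 := by
    intro j
    have h3 : pLap^[j + 1] (∑ i, X i * w i + (1 - rho m) * q) = 0 := by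
      rw [Function.iterate_succ_apply, hu]
      clear * -
      induction j with
      | zero => rfl
      | succ j ih => rw [Function.iterate_succ_apply', ih]; simp [pLap]
    have h4 := congrArg (fun p => ev p 0) h3
    rw [e, pLap_iter_add, pLap_iter_neg, pLap_iter_add, pLap_iter_rho_mul] at h4
    simp only [ev_add, ev_neg, h1 _ w hw, ev_mul, hrho, ev_smul, heul, ev_zero] at h4
    linarith
  have h5 : ∀ j : ℕ, ev (pLap^[j] q) 0 = 0 → ev q 0 = 0 := by
    intro j
    induction j with
    | zero => intro h; simpa using h
    | succ j ih =>
      intro h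
      apply ih
      rw [h2] at h
      have : (2 * (j + 1) * (m + 2 * j) : ℝ) ≠ 0 := by
        have : (0 : ℝ) < m := by exact_mod_cast (by omega : 0 < m)
        positivity
      exact (mul_eq_zero.1 h).resolve_left this
  have h6 := h5 (q.totalDegree + 1) (by rw [pLap_iter_zero _ _ le_rfl]; simp)
  rw [e]
  simp [h6, hrho]

/-- The data of the decomposition for polynomial vector fields. -/
structure PData (V : Fin m → MvPolynomial (Fin m) ℝ) (f u h : MvPolynomial (Fin m) ℝ) : Prop where
  f_sph : ∃ q, f = (1 - rho m) * q
  f_lap : pLap f = ∑ i, pderiv i (V i)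
  u_sph : ∃ q, u - ∑ i, X i * (V i - pderiv i f) = (1 - rho m) * q
  u_lap : pLap u = 0
  h_eul : eul m h = u
  h_zero : ev h 0 = 0

lemma exists_PData (hm : 2 ≤ m) (V : Fin m → MvPolynomial (Fin m) ℝ) :
    ∃ f u h, PData V f u h := by
  obtain ⟨q₁, hq₁⟩ := dirichlet hm (∑ i, pderiv i (V i))
  set f := (1 - rho m) * q₁ with hf
  set Φ := ∑ i, X i * (V i - pderiv i f) with hΦ
  obtain ⟨q₂, hq₂⟩ := dirichlet hm (- pLap Φ)
  set u := Φ + (1 - rho m) * q₂ with hu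
  have hlu : pLap u = 0 := by rw [hu, pLap_add, hq₂]; simp
  have hu0 : ev u 0 = 0 := by
    apply compat hm _ _ _ hlu
    simp only [map_sub, Finset.sum_sub_distrib]
    rw [← hq₁]; simp [pLap]
  obtain ⟨h, hh⟩ := exists_eul u
  refine ⟨f, u, h - C (ev h 0), ?_, hq₁, ?_, hlu, ?_, ?_⟩
  · exact ⟨q₁, hf⟩
  · refine ⟨q₂, ?_⟩
    rw [← hΦ, hu]; ring
  · rw [map_sub, hh, hu0]
    have : eul m (C (ev h 0)) = 0 := by rw [eul_apply]; simp
    rw [this]; simp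
  · simp

lemma PData.sub {V V' : Fin m → MvPolynomial (Fin m) ℝ} {f u h f' u' h' : MvPolynomial (Fin m) ℝ}
    (H : PData V f u h) (H' : PData V' f' u' h') :
    PData (fun i => V i - V' i) (f - f') (u - u') (h - h') where
  f_sph := by
    obtain ⟨q, hq⟩ := H.f_sph
    obtain ⟨q', hq'⟩ := H'.f_sph
    exact ⟨q - q', by rw [hq, hq']; ring⟩
  f_lap := by rw [pLap_sub, H.f_lap, H'.f_lap]; simp
  u_sph := by
    obtain ⟨q, hq⟩ := H.u_sph
    obtain ⟨q', hq'⟩ := H'.u_sph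
    refine ⟨q - q', ?_⟩
    rw [mul_sub, ← hq, ← hq', sub_sub_sub_comm, ← Finset.sum_sub_distrib]
    congr 1
    refine Finset.sum_congr rfl fun i _ => ?_
    rw [map_sub]; ring
  u_lap := by rw [pLap_sub, H.u_lap, H'.u_lap]; simp
  h_eul := by rw [map_sub, H.h_eul, H'.h_eul]
  h_zero := by simp [H.h_zero, H'.h_zero]

lemma PData.h_lap {V : Fin m → MvPolynomial (Fin m) ℝ} {f u h : MvPolynomial (Fin m) ℝ}
    (H : PData V f u h) {x : E m} (hx : x ∈ Ball m) : ev (pLap h) x = 0 := by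
  have h1 := pLap_eul h
  rw [H.h_eul, H.u_lap] at h1
  have h2 := eul_bound (p := pLap h) (B := 0) (c := 2) (by norm_num) (fun y hy => by
    have := congrArg (fun p => ev p y) h1
    simp only [ev_zero, ev_add, ev_mul, ev_two] at this
    rw [← this]; simp) x hx
  simpa using h2

end existence

section estimates
open MvPolynomial Filter

variable {m : ℕ} {ι : Type*} {l : Filter ι}

/-- The family `p` tends to zero uniformly on `s`. -/
def NullOn (l : Filter ι) (s : Set (E m)) (p : ι → MvPolynomial (Fin m) ℝ) : Prop :=
  ∀ ε > 0, ∀ᶠ n in l, ∀ x ∈ s, |ev (p n) x| ≤ ε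

lemma NullOn.mono {s t : Set (E m)} (hst : s ⊆ t) {p : ι → MvPolynomial (Fin m) ℝ}
    (h : NullOn l t p) : NullOn l s p := fun ε hε =>
  (h ε hε).mono fun _ hn x hx => hn x (hst hx)

lemma NullOn.congr {s : Set (E m)} {p q : ι → MvPolynomial (Fin m) ℝ}
    (h : NullOn l s p) (hpq : ∀ n, ∀ x ∈ s, ev (q n) x = ev (p n) x) : NullOn l s q := fun ε hε =>
  (h ε hε).mono fun n hn x hx => by rw [hpq n x hx]; exact hn x hx

lemma NullOn.add {s : Set (E m)} {p q : ι → MvPolynomial (Fin m) ℝ}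
    (hp : NullOn l s p) (hq : NullOn l s q) : NullOn l s (fun n => p n + q n) := by
  intro ε hε
  filter_upwards [hp (ε / 2) (by linarith), hq (ε / 2) (by linarith)] with n h1 h2 x hx
  rw [ev_add]
  linarith [abs_add_le (ev (p n) x) (ev (q n) x), h1 x hx, h2 x hx]

lemma NullOn.mul_left {s : Set (E m)} (hs : s ⊆ Ball m) {p : ι → MvPolynomial (Fin m) ℝ}
    (hp : NullOn l s p) (c : MvPolynomial (Fin m) ℝ) : NullOn l s (fun n => c * p n) := by
  obtain ⟨K, hK⟩ := Ball_compact.exists_bound_of_continuousOn (ev_continuous c).continuousOn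
  intro ε hε
  have hK' : 0 < |K| + 1 := by positivity
  filter_upwards [hp (ε / (|K| + 1)) (by positivity)] with n h1 x hx
  rw [ev_mul, abs_mul]
  calc |ev c x| * |ev (p n) x| ≤ (|K| + 1) * (ε / (|K| + 1)) := by
        gcongr
        · exact (hK x (hs hx)).trans (by linarith [le_abs_self K])
        · exact h1 x hx
    _ = ε := by field_simp

lemma NullOn.zero {s : Set (E m)} : NullOn l s (fun _ : ι => (0 : MvPolynomial (Fin m) ℝ)) := by
  intro ε hε
  filter_upwards with n x _
  simpa using hε.le

/-- Iterated partial derivatives. -/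
def pdl : List (Fin m) → MvPolynomial (Fin m) ℝ → MvPolynomial (Fin m) ℝ
  | [], p => p
  | i :: α, p => pdl α (pderiv i p)

lemma pdl_add (α : List (Fin m)) : ∀ p q, pdl α (p + q) = pdl α p + pdl α q := by
  induction α with
  | nil => intro p q; rfl
  | cons i α ih => intro p q; simp only [pdl, map_add, ih]

lemma pdl_zero (α : List (Fin m)) : pdl α 0 = 0 := by
  induction α with
  | nil => rfl
  | cons i α ih => simp only [pdl, map_zero, ih]

lemma pLap_pdl (α : List (Fin m)) : ∀ p, pLap (pdl α p) = pdl α (pLap p) := by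
  induction α with
  | nil => intro p; rfl
  | cons i α ih => intro p; simp only [pdl, ih, pLap_pderiv]

/-- All derivatives tend to zero uniformly on the ball. -/
def Null (l : Filter ι) (p : ι → MvPolynomial (Fin m) ℝ) : Prop :=
  ∀ α : List (Fin m), NullOn l (Ball m) (fun n => pdl α (p n))

lemma Null.pderiv {p : ι → MvPolynomial (Fin m) ℝ} (h : Null l p) (i : Fin m) :
    Null l (fun n => pderiv i (p n)) := fun α => h (i :: α)

lemma Null.add {p q : ι → MvPolynomial (Fin m) ℝ} (hp : Null l p) (hq : Null l q) :
    Null l (fun n => p n + q n) := fun α => by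
  simp only [pdl_add]; exact (hp α).add (hq α)

lemma Null.zero : Null l (fun _ : ι => (0 : MvPolynomial (Fin m) ℝ)) := fun α => by
  simp only [pdl_zero]; exact NullOn.zero

lemma Null.mul_left {p : ι → MvPolynomial (Fin m) ℝ} (hp : Null l p) (c : MvPolynomial (Fin m) ℝ) :
    Null l (fun n => c * p n) := by
  intro α
  induction α generalizing p c with
  | nil => exact (hp []).mul_left subset_rfl c
  | cons i α ih =>
    simp only [pdl, Derivation.leibniz, smul_eq_mul, pdl_add]
    refine (ih (hp.pderiv i) c).add ?_
    simp only [mul_comm _ (MvPolynomial.pderiv i c)]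
    exact ih hp _

lemma Null.neg {p : ι → MvPolynomial (Fin m) ℝ} (hp : Null l p) : Null l (fun n => - p n) := by
  simpa using hp.mul_left (-1)

lemma Null.sub {p q : ι → MvPolynomial (Fin m) ℝ} (hp : Null l p) (hq : Null l q) :
    Null l (fun n => p n - q n) := by
  simpa [sub_eq_add_neg] using hp.add hq.neg

lemma Null.sum {κ : Type*} {s : Finset κ} {p : κ → ι → MvPolynomial (Fin m) ℝ}
    (hp : ∀ k, Null l (p k)) : Null l (fun n => ∑ k ∈ s, p k n) := by
  classical
  induction s using Finset.induction_on with
  | empty => simpa using Null.zero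
  | insert a s ha ih => simp only [Finset.sum_insert ha]; exact (hp a).add ih

lemma Null.pLap {p : ι → MvPolynomial (Fin m) ℝ} (hp : Null l p) : Null l (fun n => pLap (p n)) :=
  Null.sum fun i => (hp.pderiv i).pderiv i

lemma Null.eul {p : ι → MvPolynomial (Fin m) ℝ} (hp : Null l p) : Null l (fun n => eul m (p n)) := by
  simp only [eul_apply]
  exact Null.sum fun i => (hp.pderiv i).mul_left _

lemma Null.rot {p : ι → MvPolynomial (Fin m) ℝ} (hp : Null l p) (i j : Fin m) :
    Null l (fun n => rot i j (p n)) := by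
  simp only [rot_apply]
  exact ((hp.pderiv j).mul_left _).sub ((hp.pderiv i).mul_left _)

lemma Null.eul_iter {p : ι → MvPolynomial (Fin m) ℝ} (hp : Null l p) (a : ℕ) :
    Null l (fun n => (_root_.eul m)^[a] (p n)) := by
  induction a with
  | zero => exact hp
  | succ a ih => simp only [Function.iterate_succ_apply']; exact ih.eul

/-- Levelwise smallness on the sphere for the Euler and rotation operators. -/
def G (l : Filter ι) : ℕ → (ι → MvPolynomial (Fin m) ℝ) → Prop
  | 0, p => NullOn l (Sph m) p
  | k + 1, p => G l k p ∧ G l k (fun n => eul m (p n)) ∧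
      ∀ i j, G l k (fun n => rot i j (p n))

lemma Sph_subset : Sph m ⊆ Ball m := fun _ => Sph_sub_Ball

lemma G.add {k : ℕ} : ∀ {p q : ι → MvPolynomial (Fin m) ℝ}, G l k p → G l k q →
    G l k (fun n => p n + q n) := by
  induction k with
  | zero => intro p q hp hq; exact NullOn.add hp hq
  | succ k ih =>
    intro p q hp hq
    refine ⟨ih hp.1 hq.1, ?_, fun i j => ?_⟩
    · simp only [map_add]; exact ih hp.2.1 hq.2.1
    · simp only [map_add]; exact ih (hp.2.2 i j) (hq.2.2 i j)

lemma G.mul_left {k : ℕ} : ∀ {p : ι → MvPolynomial (Fin m) ℝ}, G l k p →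
    ∀ c : MvPolynomial (Fin m) ℝ, G l k (fun n => c * p n) := by
  induction k with
  | zero => intro p hp c; exact NullOn.mul_left Sph_subset hp c
  | succ k ih =>
    intro p hp c
    refine ⟨ih hp.1 c, ?_, fun i j => ?_⟩
    · simp only [Derivation.leibniz, smul_eq_mul, mul_comm _ (eul m c)]
      exact (ih hp.2.1 c).add (ih hp.1 _)
    · simp only [Derivation.leibniz, smul_eq_mul, mul_comm _ (rot i j c)]
      exact (ih (hp.2.2 i j) c).add (ih hp.1 _)

lemma G.zero (k : ℕ) : G l k (fun _ => (0 : MvPolynomial (Fin m) ℝ)) := by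
  induction k with
  | zero => exact NullOn.zero
  | succ k ih => exact ⟨ih, by simpa using ih, fun i j => by simpa using ih⟩

lemma G.sum {k : ℕ} {κ : Type*} {s : Finset κ} {p : κ → ι → MvPolynomial (Fin m) ℝ}
    (hp : ∀ j, G l k (p j)) : G l k (fun n => ∑ j ∈ s, p j n) := by
  classical
  induction s using Finset.induction_on with
  | empty => simpa using G.zero k
  | insert a s ha ih => simp only [Finset.sum_insert ha]; exact (hp a).add ih

lemma G.of_rho {k : ℕ} : ∀ {p : ι → MvPolynomial (Fin m) ℝ}, G l k (fun n => rho m * p n) →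
    G l k p := by
  induction k with
  | zero =>
    intro p hp
    refine NullOn.congr hp fun n x hx => ?_
    simp [ev_rho, mem_Sph.1 hx]
  | succ k ih =>
    intro p hp
    refine ⟨ih hp.1, ih ?_, fun i j => ih ?_⟩
    · have := hp.2.1.add (hp.1.mul_left (-2))
      refine cast ?_ this
      congr 1
      funext n
      simp only [Derivation.leibniz, smul_eq_mul, eul_rho]
      ring
    · refine cast ?_ (hp.2.2 i j)
      congr 1
      funext n
      simp [Derivation.leibniz, rot_rho]

lemma G.pderiv {k : ℕ} {p : ι → MvPolynomial (Fin m) ℝ} (hp : G l (k + 1) p) (i : Fin m) :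
    G l k (fun n => pderiv i (p n)) := by
  apply G.of_rho
  simp only [rho_mul_pderiv]
  exact (hp.2.1.mul_left _).add (G.sum fun j => (hp.2.2 j i).mul_left _)

lemma G.pdl (α : List (Fin m)) : ∀ {p : ι → MvPolynomial (Fin m) ℝ}, G l α.length p →
    NullOn l (Sph m) (fun n => pdl α (p n)) := by
  induction α with
  | nil => intro p hp; exact hp
  | cons i α ih => intro p hp; exact ih (hp.pderiv i)

/-- Families vanishing on the sphere whose Laplacians are small. -/
def FF (l : Filter ι) (p : ι → MvPolynomial (Fin m) ℝ) : Prop :=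
  (∀ n, ∃ q, p n = (1 - rho m) * q) ∧ Null l (fun n => pLap (p n))

lemma FF.rot {p : ι → MvPolynomial (Fin m) ℝ} (hp : FF l p) (i j : Fin m) :
    FF l (fun n => rot i j (p n)) := by
  refine ⟨fun n => ?_, ?_⟩
  · obtain ⟨q, hq⟩ := hp.1 n
    refine ⟨_root_.rot i j q, ?_⟩
    simp only [hq, Derivation.leibniz, map_sub, rot_rho, Derivation.map_one_eq_zero]
    simp
  · simp only [pLap_rot]; exact hp.2.rot i j

lemma FF.sph {p : ι → MvPolynomial (Fin m) ℝ} (hp : FF l p) (n : ι) {x : E m} (hx : x ∈ Sph m) :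
    ev (p n) x = 0 := by
  obtain ⟨q, hq⟩ := hp.1 n
  simp [hq, ev_rho, mem_Sph.1 hx]

lemma eul_eul' (p : MvPolynomial (Fin m) ℝ) :
    eul m (eul m p) = rho m * pLap p + (2 - m : ℝ) • eul m p
      + (-(1 / 2) : ℝ) • ∑ i, ∑ j, rot i j (rot i j p) := by
  have h := key_identity p
  have h2 : (2 : MvPolynomial (Fin m) ℝ) = C 2 := (map_ofNat C 2).symm
  have h4 : (4 - 2 * (m : MvPolynomial (Fin m) ℝ)) = C (4 - 2 * m : ℝ) := by
    rw [map_sub, map_mul, map_ofNat C 4, map_ofNat C 2, map_natCast]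
  rw [h4, h2, ← smul_eq_C_mul, ← smul_eq_C_mul, ← smul_eq_C_mul] at h
  have h3 : ∑ i, ∑ j, rot i j (rot i j p) = (2 : ℝ) • (rho m * pLap p)
      + (4 - 2 * m : ℝ) • eul m p - (2 : ℝ) • eul m (eul m p) := by
    rw [← h]; ring
  rw [h3]
  module

lemma sph_eul_iter (hm : 2 ≤ m) (a : ℕ) : ∀ {p : ι → MvPolynomial (Fin m) ℝ}, FF l p →
    NullOn l (Sph m) (fun n => (eul m)^[a] (p n)) := by
  induction a using Nat.strong_induction_on with
  | _ a ih =>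
    intro p hp
    match a, ih with
    | 0, _ => exact NullOn.zero.congr fun n x hx => by simp [hp.sph n hx]
    | 1, _ =>
      intro ε hε
      filter_upwards [hp.2 [] (ε / 2) (by linarith)] with n hn x hx
      have := barrier hm (by linarith) (fun x hx => hp.sph n hx) hn x hx
      simpa [mul_div_cancel₀] using this
    | a + 2, ih =>
      have e : ∀ n, (eul m)^[a + 2] (p n) = (eul m)^[a] (rho m * pLap (p n))
          + C (2 - m : ℝ) * (eul m)^[a + 1] (p n)
          + C (-(1 / 2) : ℝ) * ∑ i, ∑ j, (eul m)^[a] (rot i j (rot i j (p n))) := by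
        intro n
        have h1 : ∀ q, (eul m)^[a] q = ((eul m).toLinearMap ^ a) q := fun q => by
          rw [Module.End.pow_apply]; rfl
        rw [Function.iterate_add_apply (eul m) a 2, Function.iterate_add_apply (eul m) a 1]
        simp only [Function.iterate_succ_apply, Function.iterate_zero, id]
        rw [eul_eul']
        simp only [← smul_eq_C_mul]
        simp only [h1, map_add, map_smul, map_sum]
      simp only [e]
      refine (NullOn.add ?_ ?_).add ?_
      · exact (((hp.2.mul_left (rho m)).eul_iter a) []).mono Sph_subset
      · exact (ih (a + 1) (by omega) hp).mul_left Sph_subset _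
      · refine NullOn.mul_left Sph_subset ?_ _
        have : G l 0 (fun n => ∑ i, ∑ j, (eul m)^[a] (rot i j (rot i j (p n)))) :=
          G.sum fun i => G.sum fun j => ih a (by omega) ((hp.rot i j).rot i j)
        exact this

lemma FF.G (hm : 2 ≤ m) (k : ℕ) : ∀ (a : ℕ) {p : ι → MvPolynomial (Fin m) ℝ}, FF l p →
    G l k (fun n => (eul m)^[a] (p n)) := by
  induction k with
  | zero => intro a p hp; exact sph_eul_iter hm a hp
  | succ k ih =>
    intro a p hp
    refine ⟨ih a hp, ?_, fun i j => ?_⟩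
    · simp only [← Function.iterate_succ_apply' (eul m)]
      exact ih (a + 1) hp
    · have : ∀ n, _root_.rot i j ((eul m)^[a] (p n)) = (eul m)^[a] (_root_.rot i j (p n)) := by
        intro n
        have hc : Function.Commute (_root_.rot i j) (eul m) := fun q => (eul_rot i j q).symm
        exact (hc.iterate_right a) (p n)
      simp only [this]
      exact ih a (hp.rot i j)

theorem FF.null (hm : 2 ≤ m) {p : ι → MvPolynomial (Fin m) ℝ} (hp : FF l p) : Null l p := by
  intro α
  have h1 : NullOn l (Sph m) (fun n => pdl α (p n)) := G.pdl α (FF.G hm α.length 0 hp)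
  have h2 := hp.2 α
  intro ε hε
  filter_upwards [h1 (ε / 2) (by linarith), h2 (ε / 2) (by linarith)] with n hn1 hn2 x hx
  have := max_abs hm (ev_Sm (pdl α (p n))) (A := ε / 2) (B := ε / 2) (by linarith) hn1
    (fun y hy => by rw [lap_ev _ hy, pLap_pdl]; exact hn2 y hy) x hx
  nlinarith [sq_nonneg ‖x‖]

lemma eul_null (α : List (Fin m)) : ∀ {c : ℝ} (_ : 1 ≤ c) {p q : ι → MvPolynomial (Fin m) ℝ}
    (_ : ∀ n, eul m (p n) + c • p n = q n) (_ : Null l q),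
    NullOn l (Ball m) (fun n => pdl α (p n)) := by
  induction α with
  | nil =>
    intro c hc p q hpq hq ε hε
    filter_upwards [hq [] ε hε] with n hn x hx
    refine eul_bound hc (fun y hy => ?_) x hx
    have := hn y hy
    rw [← hpq n] at this
    simpa [pdl] using this
  | cons i α ih =>
    intro c hc p q hpq hq
    refine ih (c := c + 1) (by linarith) (q := fun n => pderiv i (q n)) (fun n => ?_) (hq.pderiv i)
    rw [← hpq n, map_add, ← eul_pderiv, Derivation.map_smul, add_smul, one_smul]
    ring

lemma evD_norm (p : MvPolynomial (Fin m) ℝ) (x : E m) : ‖evD p x‖ ≤ ∑ i, |ev (pderiv i p) x| := by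
  refine ContinuousLinearMap.opNorm_le_bound _ (by positivity) fun y => ?_
  rw [evD_apply, Finset.sum_mul]
  refine (norm_sum_le _ _).trans (Finset.sum_le_sum fun i _ => ?_)
  rw [norm_mul, Real.norm_eq_abs]
  gcongr
  exact PiLp.norm_apply_le y i

theorem PData.null (hm : 2 ≤ m) {V : ι → Fin m → MvPolynomial (Fin m) ℝ}
    {f u h : ι → MvPolynomial (Fin m) ℝ} (H : ∀ n, PData (V n) (f n) (u n) (h n))
    (hV : ∀ i, Null l (fun n => V n i)) : Null l f ∧ Null l h := by
  have hf : Null l f := by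
    apply FF.null hm
    refine ⟨fun n => (H n).f_sph, ?_⟩
    simp only [(H _).f_lap]
    exact Null.sum fun i => (hV i).pderiv i
  have hΦ : Null l (fun n => ∑ i, X i * (V n i - MvPolynomial.pderiv i (f n))) :=
    Null.sum fun i => ((hV i).sub (hf.pderiv i)).mul_left _
  have hu : Null l u := by
    have h1 : Null l (fun n => u n - ∑ i, X i * (V n i - MvPolynomial.pderiv i (f n))) := by
      apply FF.null hm
      refine ⟨fun n => (H n).u_sph, ?_⟩
      simp only [pLap_sub, (H _).u_lap, zero_sub]
      exact hΦ.pLap.neg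
    simpa using h1.add hΦ
  refine ⟨hf, ?_⟩
  have hd : ∀ i, Null l (fun n => MvPolynomial.pderiv i (h n)) := fun i α => by
    refine eul_null α (c := 1) le_rfl (q := fun n => MvPolynomial.pderiv i (u n)) (fun n => ?_)
      (hu.pderiv i)
    rw [one_smul, eul_pderiv, (H n).h_eul]
  intro α
  match α with
  | i :: α => exact hd i α
  | [] =>
    intro ε hε
    have hev : ∀ᶠ n in l, ∀ i, ∀ x ∈ Ball m, |ev (MvPolynomial.pderiv i (h n)) x| ≤ ε / (m + 1) :=
      eventually_all.2 fun i => hd i [] _ (by positivity)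
    filter_upwards [hev] with n hn x hx
    have h3 := (convex_closedBall (0 : E m) 1).norm_image_sub_le_of_norm_hasFDerivWithin_le
      (f := ev (h n)) (C := ε)
      (fun y _ => (ev_hasFDerivAt (h n) y).hasFDerivWithinAt) (fun y hy => ?_)
      (x := 0) (y := x) (by simp) hx
    · rw [(H n).h_zero, sub_zero, sub_zero, Real.norm_eq_abs] at h3
      have := mem_Ball.1 hx
      exact h3.trans (by nlinarith)
    · refine (evD_norm _ _).trans ((Finset.sum_le_sum fun i _ => hn i y hy).trans ?_)
      simp only [Finset.sum_const, Finset.card_univ, Fintype.card_fin, nsmul_eq_mul]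
      rw [mul_div_assoc', div_le_iff₀ (by positivity)]
      nlinarith

end estimates

section limits
open MvPolynomial Filter Topology

variable {m : ℕ}

/-- Cauchy in the smooth topology on the ball. -/
def CN (p : ℕ → MvPolynomial (Fin m) ℝ) : Prop :=
  Null (atTop ×ˢ atTop : Filter (ℕ × ℕ)) (fun k => p k.1 - p k.2)

/-- Pointwise limit on the ball. -/
def Lim (p : ℕ → MvPolynomial (Fin m) ℝ) (F : E m → ℝ) : Prop :=
  ∀ x ∈ Ball m, Tendsto (fun n => ev (p n) x) atTop (𝓝 (F x))

lemma CN.pderiv {p : ℕ → MvPolynomial (Fin m) ℝ} (h : CN p) (i : Fin m) :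
    CN (fun n => pderiv i (p n)) := by
  have := Null.pderiv h i
  simpa only [CN, map_sub] using this

lemma CN.sub {p q : ℕ → MvPolynomial (Fin m) ℝ} (hp : CN p) (hq : CN q) :
    CN (fun n => p n - q n) := by
  have h := Null.sub hp hq
  unfold CN
  convert h using 2
  ring

lemma CN.unif {p : ℕ → MvPolynomial (Fin m) ℝ} (h : CN p) {ε : ℝ} (hε : 0 < ε) :
    ∃ N, ∀ n ≥ N, ∀ k ≥ N, ∀ x ∈ Ball m, |ev (p n) x - ev (p k) x| ≤ ε := by
  have h1 := h [] ε hε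
  rw [prod_atTop_atTop_eq, eventually_atTop] at h1
  obtain ⟨⟨a, b⟩, hab⟩ := h1
  refine ⟨max a b, fun n hn k hk x hx => ?_⟩
  have := hab (n, k) ⟨(le_max_left _ _).trans hn, (le_max_right _ _).trans hk⟩ x hx
  simpa [pdl] using this

lemma CN.exists_lim {p : ℕ → MvPolynomial (Fin m) ℝ} (h : CN p) : ∃ F, Lim p F := by
  have : ∀ x : E m, ∃ y : ℝ, x ∈ Ball m → Tendsto (fun n => ev (p n) x) atTop (𝓝 y) := by
    intro x
    by_cases hx : x ∈ Ball m
    · have hc : CauchySeq (fun n => ev (p n) x) := by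
        refine Metric.cauchySeq_iff.2 fun ε hε => ?_
        obtain ⟨N, hN⟩ := h.unif (half_pos hε)
        refine ⟨N, fun n hn k hk => ?_⟩
        rw [Real.dist_eq]
        linarith [hN n hn k hk x hx]
      obtain ⟨y, hy⟩ := cauchySeq_tendsto_of_complete hc
      exact ⟨y, fun _ => hy⟩
    · exact ⟨0, fun h => absurd h hx⟩
  choose F hF using this
  exact ⟨F, hF⟩

lemma CN.hasFDeriv {p : ℕ → MvPolynomial (Fin m) ℝ} (h : CN p) {F : E m → ℝ} (hF : Lim p F)
    {G : Fin m → E m → ℝ} (hG : ∀ i, Lim (fun n => MvPolynomial.pderiv i (p n)) (G i))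
    {x : E m} (hx : x ∈ Ball m) :
    HasFDerivWithinAt F (∑ i, G i x • (EuclideanSpace.proj i : E m →L[ℝ] ℝ)) (Ball m) x := by
  rw [hasFDerivWithinAt_iff_isLittleO, Asymptotics.isLittleO_iff]
  intro c hc
  have hε : 0 < c / (2 * m + 1) := by positivity
  set ε := c / (2 * m + 1) with hεdef
  have hU : ∃ N, ∀ i, ∀ n ≥ N, ∀ k ≥ N, ∀ x ∈ Ball m,
      |ev (MvPolynomial.pderiv i (p n)) x - ev (MvPolynomial.pderiv i (p k)) x| ≤ ε := by
    choose N hN using fun i => (h.pderiv i).unif hε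
    refine ⟨∑ i, N i, fun i n hn k hk => ?_⟩
    have hi : N i ≤ ∑ i, N i := Finset.single_le_sum (fun _ _ => Nat.zero_le _) (Finset.mem_univ i)
    exact hN i n (hi.trans hn) k (hi.trans hk)
  obtain ⟨N, hN⟩ := hU
  have h1 : ∀ n ≥ N, ∀ y ∈ Ball m, |ev (p n - p N) y - ev (p n - p N) x| ≤ m * ε * ‖y - x‖ := by
    intro n hn y hy
    have := Convex.norm_image_sub_le_of_norm_hasFDerivWithin_le (𝕜 := ℝ) (s := Ball m)
      (f := ev (p n - p N)) (f' := evD (p n - p N)) (C := m * ε)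
      (fun z hz => (ev_hasFDerivAt _ z).hasFDerivWithinAt) (fun z hz => ?_)
      (convex_closedBall _ _) hx hy
    · simpa using this
    · refine (evD_norm _ z).trans ?_
      refine (Finset.sum_le_card_nsmul _ _ ε fun i _ => ?_).trans (by simp)
      simpa using hN i n hn N le_rfl z hz
  have h2 : ∀ y ∈ Ball m, |(F y - ev (p N) y) - (F x - ev (p N) x)| ≤ m * ε * ‖y - x‖ := by
    intro y hy
    have ht : Tendsto (fun n => |ev (p n - p N) y - ev (p n - p N) x|) atTop
        (𝓝 |(F y - ev (p N) y) - (F x - ev (p N) x)|) := by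
      simp only [ev_sub]
      exact (((hF y hy).sub_const _).sub ((hF x hx).sub_const _)).abs
    exact le_of_tendsto ht (eventually_atTop.2 ⟨N, fun n hn => h1 n hn y hy⟩)
  have h3 : ∀ i, |ev (MvPolynomial.pderiv i (p N)) x - G i x| ≤ ε := by
    intro i
    have ht := ((hG i x hx).const_sub (ev (MvPolynomial.pderiv i (p N)) x)).abs
    exact le_of_tendsto ht (eventually_atTop.2 ⟨N, fun n hn => hN i N le_rfl n hn x hx⟩)
  have h4 := hasFDerivWithinAt_iff_isLittleO.1
    ((ev_hasFDerivAt (p N) x).hasFDerivWithinAt (s := Ball m))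
  rw [Asymptotics.isLittleO_iff] at h4
  filter_upwards [h4 hε, self_mem_nhdsWithin] with y hy hyB
  have h5 : |evD (p N) x (y - x) - (∑ i, G i x • (EuclideanSpace.proj i : E m →L[ℝ] ℝ)) (y - x)|
      ≤ m * ε * ‖y - x‖ := by
    have e : evD (p N) x (y - x) - (∑ i, G i x • (EuclideanSpace.proj i : E m →L[ℝ] ℝ)) (y - x)
        = ∑ i, (ev (MvPolynomial.pderiv i (p N)) x - G i x) * (y - x) i := by
      rw [evD_apply]
      simp [sub_mul, Finset.sum_sub_distrib]
    rw [e]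
    refine (Finset.abs_sum_le_sum_abs _ _).trans ?_
    refine (Finset.sum_le_card_nsmul _ _ (ε * ‖y - x‖) fun i _ => ?_).trans (by simp [mul_assoc])
    rw [abs_mul]
    exact mul_le_mul (h3 i) (by simpa using PiLp.norm_apply_le (y - x) i) (abs_nonneg _) hε.le
  rw [Real.norm_eq_abs] at hy ⊢
  have h6 := h2 y hyB
  have e : c = (2 * m + 1) * ε := by rw [hεdef]; field_simp
  rw [e]
  rw [abs_le] at h5 h6 hy ⊢
  constructor <;> nlinarith

lemma CN.smooth_aux (n : ℕ) : ∀ {p : ℕ → MvPolynomial (Fin m) ℝ} (_ : CN p) {F : E m → ℝ}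
    (_ : Lim p F), ContDiffOn ℝ n F (Ball m) := by
  induction n with
  | zero =>
    intro p h F hF
    choose G hG using fun i => (h.pderiv i).exists_lim
    exact contDiffOn_zero.2 fun x hx => (h.hasFDeriv hF hG hx).continuousWithinAt
  | succ n ih =>
    intro p h F hF
    choose G hG using fun i => (h.pderiv i).exists_lim
    rw [Nat.cast_succ, contDiffOn_succ_iff_fderivWithin Ball_ud]
    refine ⟨fun x hx => (h.hasFDeriv hF hG hx).differentiableWithinAt, by simp, ?_⟩
    have : ContDiffOn ℝ n (fun x => ∑ i, G i x • (EuclideanSpace.proj i : E m →L[ℝ] ℝ)) (Ball m) :=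
      ContDiffOn.sum fun i _ => (ih (h.pderiv i) (hG i)).smul contDiffOn_const
    exact this.congr fun x hx => (h.hasFDeriv hF hG hx).fderivWithin (Ball_ud x hx)

lemma CN.smooth {p : ℕ → MvPolynomial (Fin m) ℝ} (h : CN p) {F : E m → ℝ}
    (hF : Lim p F) : Sm F := contDiffOn_infty.2 fun n => CN.smooth_aux n h hF

lemma CN.lim_pd {p : ℕ → MvPolynomial (Fin m) ℝ} (h : CN p) {F : E m → ℝ}
    (hF : Lim p F) (i : Fin m) : Lim (fun n => MvPolynomial.pderiv i (p n)) (pd i F) := by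
  choose G hG using fun i => (h.pderiv i).exists_lim
  intro x hx
  rw [pd_eq_of_hasFDerivWithinAt hx (h.hasFDeriv hF hG hx) i]
  simpa using hG i x hx

end limits

section density
open MvPolynomial Filter Topology MeasureTheory
open scoped Convolution

variable {m : ℕ}

/-- Smooth functions supported in the ball of radius two. -/
def TF (φ : E m → ℝ) : Prop := ContDiff ℝ (⊤ : ℕ∞) φ ∧ ∀ y, 2 < ‖y‖ → φ y = 0

/-- Directional derivative. -/
def dd (i : Fin m) (φ : E m → ℝ) : E m → ℝ := fun y => fderiv ℝ φ y (EuclideanSpace.single i 1)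

lemma TF.compact {φ : E m → ℝ} (h : TF φ) : HasCompactSupport φ := by
  refine HasCompactSupport.of_support_subset_isCompact (isCompact_closedBall (0 : E m) 2) ?_
  intro y hy
  by_contra hc
  exact hy (h.2 y (by simpa using hc))

lemma TF.dd {φ : E m → ℝ} (h : TF φ) (i : Fin m) : TF (dd i φ) := by
  refine ⟨?_, fun y hy => ?_⟩
  · exact (h.1.fderiv_right (m := ((⊤ : ℕ∞) : WithTop ℕ∞)) (by simp)).clm_apply contDiff_const
  · have : φ =ᶠ[𝓝 y] fun _ => 0 := by
      filter_upwards [(isOpen_lt continuous_const continuous_norm).mem_nhds hy] with z hz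
      exact h.2 z hz
    simp [_root_.dd, this.fderiv_eq]

lemma conv_integrable {φ : E m → ℝ} (hc : Continuous φ) (hs : HasCompactSupport φ)
    (K : MvPolynomial (Fin m) ℝ) (x : E m) : Integrable (fun y => φ y * ev K (x - y)) :=
  (hc.mul ((ev_continuous K).comp (continuous_const.sub continuous_id))).integrable_of_hasCompactSupport
    hs.mul_right

lemma exists_conv (K : MvPolynomial (Fin m) ℝ) : ∀ {φ : E m → ℝ} (_ : Continuous φ)
    (_ : HasCompactSupport φ), ∃ T : MvPolynomial (Fin m) ℝ, ∀ x, ev T x = ∫ y, φ y * ev K (x - y) := by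
  induction K using MvPolynomial.induction_on with
  | C a =>
    intro φ hc hs
    exact ⟨C ((∫ y, φ y) * a), fun x => by simp [integral_mul_const]⟩
  | add p q hp hq =>
    intro φ hc hs
    obtain ⟨T1, h1⟩ := hp hc hs
    obtain ⟨T2, h2⟩ := hq hc hs
    refine ⟨T1 + T2, fun x => ?_⟩
    simp only [ev_add, mul_add]
    rw [integral_add (conv_integrable hc hs p x) (conv_integrable hc hs q x), h1, h2]
  | mul_X p i hp =>
    intro φ hc hs
    have hc' : Continuous fun y : E m => φ y * y i :=
      hc.mul (EuclideanSpace.proj (𝕜 := ℝ) i).continuous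
    have hs' : HasCompactSupport fun y : E m => φ y * y i := hs.mul_right
    obtain ⟨T1, h1⟩ := hp hc hs
    obtain ⟨T2, h2⟩ := hp hc' hs'
    refine ⟨X i * T1 - T2, fun x => ?_⟩
    rw [ev_sub, ev_mul, ev_X, h1, h2, ← integral_const_mul, ← integral_sub
      ((conv_integrable hc hs p x).const_mul _) (conv_integrable hc' hs' p x)]
    refine integral_congr_ae (Eventually.of_forall fun y => ?_)
    simp
    ring

/-- The polynomial Landau kernel. -/
def LK (m n : ℕ) : MvPolynomial (Fin m) ℝ := (1 - C (1 / 9) * rho m) ^ n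

lemma ev_LK (n : ℕ) (x : E m) : ev (LK m n) x = (1 - ‖x‖ ^ 2 / 9) ^ n := by
  have : ev (LK m n) x = (ev (1 - C (1 / 9) * rho m) x) ^ n := by simp [LK, ev]
  rw [this]
  simp [ev_rho]
  ring

/-- Normalising constant. -/
def LZ (m n : ℕ) : ℝ := ∫ x in Metric.closedBall (0 : E m) 3, (1 - ‖x‖ ^ 2 / 9) ^ n

open Classical in
/-- Convolution with the Landau kernel. -/
def AP (n : ℕ) (φ : E m → ℝ) : MvPolynomial (Fin m) ℝ :=
  if h : ∃ T : MvPolynomial (Fin m) ℝ, ∀ x, ev T x = ∫ y, φ y * ev (LK m n) (x - y) then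
    C (LZ m n)⁻¹ * h.choose else 0

lemma ev_AP (n : ℕ) {φ : E m → ℝ} (h : TF φ) (x : E m) :
    ev (AP n φ) x = (LZ m n)⁻¹ * ∫ y, φ y * ev (LK m n) (x - y) := by
  have := exists_conv (LK m n) h.1.continuous h.compact
  rw [AP, dif_pos this, ev_mul, ev_C, this.choose_spec x]

lemma pderiv_AP (hm : 2 ≤ m) (n : ℕ) {φ : E m → ℝ} (h : TF φ) (i : Fin m) :
    pderiv i (AP n φ) = AP n (dd i φ) := by
  rw [← sub_eq_zero]
  apply eq_zero_of_ball hm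
  intro x _
  rw [ev_sub, sub_eq_zero, ev_AP n (h.dd i)]
  have h1 : ev (AP n φ) = fun x => (LZ m n)⁻¹ *
      (φ ⋆[ContinuousLinearMap.mul ℝ ℝ, volume] (ev (LK m n))) x := by
    ext x
    rw [ev_AP n h, convolution_def]
    simp
  have h2 := (h.compact.hasFDerivAt_convolution_left (ContinuousLinearMap.mul ℝ ℝ) (μ := volume)
    (h.1.of_le (by exact_mod_cast le_top))
    (ev_continuous (LK m n)).locallyIntegrable x).const_mul (LZ m n)⁻¹
  have h3 := ev_hasFDerivAt (AP n φ) x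
  rw [h1] at h3
  have h4 := h3.unique h2
  have h5 : evD (AP n φ) x (EuclideanSpace.single i 1) = ev (pderiv i (AP n φ)) x := by
    rw [evD_apply]; simp
  rw [← h5, h4, smul_apply, smul_eq_mul, convolution_def,
    ContinuousLinearMap.integral_apply]
  · rfl
  · have hcc : Continuous (fun t => fderiv ℝ φ t) := h.1.continuous_fderiv (by simp)
    refine Continuous.integrable_of_hasCompactSupport ?_ ?_
    · refine ((ContinuousLinearMap.mul ℝ ℝ).precompL (E m)).continuous₂.comp
        (hcc.prodMk ((ev_continuous (LK m n)).comp (continuous_const.sub continuous_id)))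
    · refine (h.compact.fderiv ℝ).mono ?_
      intro t ht hz
      apply ht
      simp only [hz, map_zero, zero_apply]

lemma LZ_pos (n : ℕ) : 0 < LZ m n := by
  have hc : Continuous fun x : E m => (1 - ‖x‖ ^ 2 / 9) ^ n := by fun_prop
  rw [LZ, setIntegral_pos_iff_support_of_nonneg_ae]
  · refine (Metric.measure_ball_pos volume (0 : E m) (by norm_num : (0 : ℝ) < 3)).trans_le ?_
    refine measure_mono fun x hx => ⟨?_, Metric.ball_subset_closedBall hx⟩
    have h1 : ‖x‖ < 3 := by simpa using hx
    have h2 : 0 < 1 - ‖x‖ ^ 2 / 9 := by nlinarith [norm_nonneg x]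
    exact (pow_pos h2 n).ne'
  · filter_upwards [ae_restrict_mem measurableSet_closedBall] with z hz
    have h1 : ‖z‖ ≤ 3 := by simpa using hz
    have h2 : 0 ≤ 1 - ‖z‖ ^ 2 / 9 := by nlinarith [norm_nonneg z]
    exact pow_nonneg h2 n
  · exact hc.continuousOn.integrableOn_compact (isCompact_closedBall _ _)

/-- Error constant. -/
def LErr (m n : ℕ) : ℝ :=
  (LZ m n)⁻¹ * ∫ x in Metric.closedBall (0 : E m) 3, (1 - ‖x‖ ^ 2 / 9) ^ n * ‖x‖

lemma LErr_tendsto : Tendsto (LErr m) atTop (𝓝 0) := by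
  have := tendsto_setIntegral_pow_smul_of_unique_maximum_of_isCompact_of_continuousOn
    (μ := (volume : Measure (E m))) (s := Metric.closedBall (0 : E m) 3) (x₀ := 0)
    (c := fun x => 1 - ‖x‖ ^ 2 / 9) (g := fun x => ‖x‖)
    (isCompact_closedBall _ _) (by fun_prop) ?_ ?_ (by simp) ?_ (by fun_prop)
  · simp only [smul_eq_mul, norm_zero] at this
    exact this
  · intro y _ hy
    have : 0 < ‖y‖ := norm_pos_iff.2 hy
    simp
    positivity
  · intro y hy
    have h1 : ‖y‖ ≤ 3 := by simpa using hy
    nlinarith [norm_nonneg y]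
  · rw [interior_closedBall _ (by norm_num), closure_ball _ (by norm_num)]
    simp

lemma AP_bound {φ : E m → ℝ} (h : TF φ) : ∃ L : ℝ, 0 ≤ L ∧ ∀ n, ∀ x ∈ Ball m,
    |ev (AP n φ) x - φ x| ≤ L * LErr m n := by
  obtain ⟨K, hK⟩ := h.1.lipschitzWith_of_hasCompactSupport h.compact (by simp)
  refine ⟨K, K.2, fun n x hx => ?_⟩
  have hZ := LZ_pos (m := m) n
  have hi : ∀ {g : E m → ℝ}, Continuous g → IntegrableOn g (Metric.closedBall (0 : E m) 3) :=
    fun hg => hg.continuousOn.integrableOn_compact (isCompact_closedBall _ _)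
  have e1 : ∫ y, φ y * ev (LK m n) (x - y) =
      ∫ z in Metric.closedBall (0 : E m) 3, φ (x - z) * (1 - ‖z‖ ^ 2 / 9) ^ n := by
    rw [← integral_sub_left_eq_self _ volume x, setIntegral_eq_integral_of_forall_compl_eq_zero]
    · simp [ev_LK]
    · intro z hz
      have hz' : 3 < ‖z‖ := by simpa using hz
      rw [h.2 _, zero_mul]
      have := norm_sub_norm_le z x
      rw [norm_sub_rev] at this
      linarith [mem_Ball.1 hx]
  have e2 : ev (AP n φ) x - φ x = (LZ m n)⁻¹ *
      ∫ z in Metric.closedBall (0 : E m) 3, (φ (x - z) - φ x) * (1 - ‖z‖ ^ 2 / 9) ^ n := by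
    simp only [sub_mul (φ _)]
    rw [integral_sub (hi ?_) (hi (by fun_prop)), integral_const_mul, ev_AP n h, e1, mul_sub]
    · congr 1
      change _ = (LZ m n)⁻¹ * (φ x * LZ m n)
      field_simp
    · exact (h.1.continuous.comp (continuous_const.sub continuous_id)).mul (by fun_prop)
  rw [e2, abs_mul, abs_of_pos (inv_pos.2 hZ), LErr, mul_left_comm]
  gcongr
  rw [← integral_const_mul]
  have hInt : IntegrableOn (fun z : E m => (K : ℝ) * ((1 - ‖z‖ ^ 2 / 9) ^ n * ‖z‖))
      (Metric.closedBall (0 : E m) 3) := hi (by fun_prop)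
  refine norm_integral_le_of_norm_le (f := fun z : E m =>
    (φ (x - z) - φ x) * (1 - ‖z‖ ^ 2 / 9) ^ n) hInt ?_
  filter_upwards [ae_restrict_mem measurableSet_closedBall] with z hz
  have h1 : ‖z‖ ≤ 3 := by simpa using hz
  have h2 : 0 ≤ 1 - ‖z‖ ^ 2 / 9 := by nlinarith [norm_nonneg z]
  rw [Real.norm_eq_abs, abs_mul, abs_of_nonneg (pow_nonneg h2 n)]
  have h3 := hK.dist_le_mul (x - z) x
  rw [Real.dist_eq] at h3
  simp at h3
  calc _ ≤ K * ‖z‖ * (1 - ‖z‖ ^ 2 / 9) ^ n := by gcongr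
    _ = _ := by ring

lemma AP_unif {φ : E m → ℝ} (h : TF φ) {ε : ℝ} (hε : 0 < ε) : ∀ᶠ n in atTop, ∀ x ∈ Ball m,
    |ev (AP n φ) x - φ x| ≤ ε := by
  obtain ⟨L, hL, hb⟩ := AP_bound h
  have h1 : Tendsto (fun n => L * LErr m n) atTop (𝓝 0) := by simpa using LErr_tendsto.const_mul L
  filter_upwards [h1.eventually (ge_mem_nhds hε)] with n hn x hx
  exact (hb n x hx).trans hn

lemma pdl_AP (hm : 2 ≤ m) (α : List (Fin m)) : ∀ {φ : E m → ℝ} (_ : TF φ),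
    ∃ ψ, TF ψ ∧ ∀ n, pdl α (AP n φ) = AP n ψ := by
  induction α with
  | nil => intro φ h; exact ⟨φ, h, fun _ => rfl⟩
  | cons i α ih =>
    intro φ h
    obtain ⟨ψ, h1, h2⟩ := ih (h.dd i)
    refine ⟨ψ, h1, fun n => ?_⟩
    rw [pdl, pderiv_AP hm n h, h2]

lemma pdl_sub (α : List (Fin m)) : ∀ p q, pdl α (p - q) = pdl α p - pdl α q := by
  induction α with
  | nil => intro p q; rfl
  | cons i α ih => intro p q; simp only [pdl, map_sub, ih]

lemma AP_CN (hm : 2 ≤ m) {φ : E m → ℝ} (h : TF φ) : CN (fun n => AP n φ) := by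
  intro α ε hε
  obtain ⟨ψ, h1, h2⟩ := pdl_AP hm α h
  have h3 := AP_unif h1 (half_pos hε)
  filter_upwards [(h3.prod_mk h3 : ∀ᶠ k in (atTop ×ˢ atTop : Filter (ℕ × ℕ)), _)] with k hk x hx
  rw [pdl_sub, h2, h2, ev_sub]
  have a := hk.1 x hx
  have b := hk.2 x hx
  rw [abs_le] at a b ⊢
  constructor <;> linarith

lemma AP_lim {φ : E m → ℝ} (h : TF φ) : Lim (fun n => AP n φ) φ := by
  intro x hx
  refine Metric.tendsto_nhds.2 fun ε hε => ?_
  filter_upwards [AP_unif h (half_pos hε)] with n hn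
  rw [Real.dist_eq]
  linarith [hn x hx]

lemma exists_cutoff {v : E m → ℝ} {U : Set (E m)} (hU : IsOpen U) (hB : Ball m ⊆ U)
    (hv : ContDiffOn ℝ (⊤ : ℕ∞) v U) : ∃ φ, TF φ ∧ ∀ x ∈ Ball m, φ x = v x := by
  obtain ⟨δ, hδ, hsub⟩ := Ball_compact.exists_cthickening_subset_open hU hB
  rw [Ball, cthickening_closedBall hδ.le zero_le_one] at hsub
  have hr : 1 < 1 + min δ 1 := by have := lt_min hδ one_pos; linarith
  let χ : ContDiffBump (0 : E m) := ⟨1, 1 + min δ 1, one_pos, hr⟩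
  have hts : tsupport χ ⊆ U := by
    rw [χ.tsupport_eq]
    refine (Metric.closedBall_subset_closedBall ?_).trans hsub
    change 1 + min δ 1 ≤ _
    linarith [min_le_left δ 1]
  refine ⟨fun x => χ x * v x, ⟨?_, fun y hy => ?_⟩, fun x hx => ?_⟩
  · rw [contDiff_iff_contDiffAt]
    intro x
    by_cases hx : x ∈ U
    · exact χ.contDiff.contDiffAt.mul (hv.contDiffAt (hU.mem_nhds hx))
    · have h0 : χ =ᶠ[𝓝 x] 0 := notMem_tsupport_iff_eventuallyEq.1 fun h => hx (hts h)
      refine (contDiffAt_const (c := (0 : ℝ))).congr_of_eventuallyEq ?_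
      filter_upwards [h0] with y hy
      simp [hy]
  · have : χ y = 0 := χ.zero_of_le_dist (by
      change 1 + min δ 1 ≤ _
      simp only [dist_zero_right]
      linarith [min_le_right δ 1])
    simp [this]
  · have : χ x = 1 := χ.one_of_mem_closedBall hx
    simp [this]

theorem exists_approx (hm : 2 ≤ m) {v : E m → ℝ} {U : Set (E m)} (hU : IsOpen U) (hB : Ball m ⊆ U)
    (hv : ContDiffOn ℝ (⊤ : ℕ∞) v U) : ∃ p : ℕ → MvPolynomial (Fin m) ℝ, CN p ∧ Lim p v := by
  obtain ⟨φ, h1, h2⟩ := exists_cutoff hU hB hv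
  refine ⟨_, AP_CN hm h1, fun x hx => ?_⟩
  rw [← h2 x hx]
  exact AP_lim h1 x hx

end density

section final
open MvPolynomial Filter Topology

variable {m : ℕ}

theorem main_exists (hm : 2 ≤ m) (v : Fin m → E m → ℝ) {U : Set (E m)} (hU : IsOpen U)
    (hB : Ball m ⊆ U) (hv : ∀ i, ContDiffOn ℝ (⊤ : ℕ∞) (v i) U) :
    ∃ (f h : E m → ℝ) (w : Fin m → E m → ℝ),
      ContDiffOn ℝ (⊤ : ℕ∞) f (Ball m) ∧ ContDiffOn ℝ (⊤ : ℕ∞) h (Ball m) ∧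
      (∀ i, ContDiffOn ℝ (⊤ : ℕ∞) (w i) (Ball m)) ∧
      (∀ i, ∀ x ∈ Ball m, v i x = pd i f x + pd i h x + w i x) ∧
      (∀ x ∈ Sph m, f x = 0) ∧
      (∀ x ∈ Ball m, lap h x = 0) ∧
      (∀ x ∈ Ball m, ∑ i, pd i (w i) x = 0) ∧
      (∀ x ∈ Sph m, ∑ k, w k x * x k = 0) := by
  choose V hV hVl using fun i => exists_approx hm hU hB (hv i)
  choose f u h H using fun n => exists_PData hm (fun i => V i n)
  have hN := PData.null (l := (atTop ×ˢ atTop : Filter (ℕ × ℕ))) hm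
    (fun k : ℕ × ℕ => (H k.1).sub (H k.2)) hV
  have hf : CN f := hN.1
  have hh : CN h := hN.2
  obtain ⟨F, hF⟩ := hf.exists_lim
  obtain ⟨J, hJ⟩ := hh.exists_lim
  have hW : ∀ i, CN (fun n => V i n - pderiv i (f n) - pderiv i (h n)) := fun i =>
    ((hV i).sub (hf.pderiv i)).sub (hh.pderiv i)
  have hWl : ∀ i, Lim (fun n => V i n - pderiv i (f n) - pderiv i (h n))
      (fun x => v i x - pd i F x - pd i J x) := by
    intro i x hx
    simp only [ev_sub]
    exact ((hVl i x hx).sub (hf.lim_pd hF i x hx)).sub (hh.lim_pd hJ i x hx)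
  refine ⟨F, J, fun i x => v i x - pd i F x - pd i J x, hf.smooth hF, hh.smooth hJ,
    fun i => (hW i).smooth (hWl i), fun i x _ => by ring, ?_, ?_, ?_, ?_⟩
  · intro x hx
    refine tendsto_nhds_unique (hF x (Sph_sub_Ball hx)) ?_
    have : ∀ n, ev (f n) x = 0 := fun n => by
      obtain ⟨q, hq⟩ := (H n).f_sph
      rw [hq]; simp [ev_rho, mem_Sph.1 hx]
    simp [this]
  · intro x hx
    have h1 : Tendsto (fun n => ∑ i, ev (pderiv i (pderiv i (h n))) x) atTop (𝓝 (lap J x)) :=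
      tendsto_finsetSum _ fun i _ => (hh.pderiv i).lim_pd (hh.lim_pd hJ i) i x hx
    refine tendsto_nhds_unique h1 ?_
    have : ∀ n, ∑ i, ev (pderiv i (pderiv i (h n))) x = 0 := fun n => by
      rw [← (H n).h_lap hx, pLap, ev_sum]
    simp [this]
  · intro x hx
    have h1 := tendsto_finsetSum Finset.univ fun i _ => (hW i).lim_pd (hWl i) i x hx
    refine tendsto_nhds_unique h1 ?_
    have : ∀ n, ∑ i, ev (pderiv i (V i n - pderiv i (f n) - pderiv i (h n))) x = 0 := fun n => by
      have h2 := congrArg (fun p => ev p x) (H n).f_lap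
      have h3 := (H n).h_lap hx
      simp only [pLap, ev_sum] at h2 h3
      simp only [map_sub, ev_sub, Finset.sum_sub_distrib, h2, h3]
      ring
    simp only [this, tendsto_const_nhds]
  · intro x hx
    have h1 := tendsto_finsetSum Finset.univ fun i _ =>
      (hWl i x (Sph_sub_Ball hx)).mul_const (x i)
    refine tendsto_nhds_unique h1 ?_
    have : ∀ n, ∑ i, ev (V i n - pderiv i (f n) - pderiv i (h n)) x * x i = 0 := fun n => by
      obtain ⟨q, hq⟩ := (H n).u_sph
      have h2 := congrArg (fun p => ev p x) hq
      rw [← (H n).h_eul] at h2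
      simp only [ev_sub, ev_mul, ev_sum, ev_X, ev_one, ev_rho, mem_Sph.1 hx, ev_eul, evD_apply] at h2
      simp only [ev_sub, sub_mul, mul_sub, Finset.sum_sub_distrib] at h2 ⊢
      simp only [mul_comm (x _)] at h2
      linarith
    simp only [this, tendsto_const_nhds]

lemma pd_zero_of_eq {f : E m → ℝ} {c : ℝ} (h : ∀ x ∈ Ball m, f x = c) (i : Fin m) {x : E m}
    (hx : x ∈ Ball m) : pd i f x = 0 := by
  have := pd_eq_of_hasFDerivWithinAt hx
    ((hasFDerivWithinAt_const c x (Ball m)).congr h (h x hx)) i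
  simpa using this

theorem main_unique (hm : 2 ≤ m) {f h : E m → ℝ} {w : Fin m → E m → ℝ}
    (hf : Sm f) (hh : Sm h) (hw : ∀ i, Sm (w i))
    (hfS : ∀ x ∈ Sph m, f x = 0)
    (hL : ∀ x ∈ Ball m, lap h x = 0)
    (hdiv : ∀ x ∈ Ball m, ∑ i, pd i (w i) x = 0)
    (hwS : ∀ x ∈ Sph m, ∑ k, w k x * x k = 0)
    (hsum : ∀ i, ∀ x ∈ Ball m, pd i f x + pd i h x + w i x = 0) :
    ((∀ x ∈ Ball m, f x = 0) ∧
       (∃ c : ℝ, ∀ x ∈ Ball m, h x = c) ∧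
       (∀ i, ∀ x ∈ Ball m, w i x = 0)) := by
  have hz : ∀ {g : E m → ℝ}, Sm g → (∀ x ∈ Sph m, g x = 0) → (∀ x ∈ Ball m, lap g x = 0) →
      ∀ x ∈ Ball m, g x = 0 := by
    intro g hg h1 h2 x hx
    have := max_abs hm hg (A := 0) (B := 0) le_rfl (fun y hy => by simp [h1 y hy])
      (fun y hy => by simp [h2 y hy]) x hx
    simpa using this
  have hf0 : ∀ x ∈ Ball m, f x = 0 := by
    refine hz hf hfS fun x hx => ?_
    have h1 : ∀ i, pd i (pd i f) x + pd i (pd i h) x + pd i (w i) x = 0 := by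
      intro i
      rw [← pd_add (hf.pd i) (hh.pd i) i hx, ← pd_add ((hf.pd i).add (hh.pd i)) (hw i) i hx]
      exact pd_zero_of_eq (hsum i) i hx
    have h2 := Finset.sum_congr (rfl : (Finset.univ : Finset (Fin m)) = _) fun i _ => h1 i
    simp only [Finset.sum_add_distrib, Finset.sum_const_zero] at h2
    have h3 := hL x hx
    have h4 := hdiv x hx
    simp only [lap] at h3 ⊢
    linarith
  have hwh : ∀ i, ∀ x ∈ Ball m, w i x = - pd i h x := by
    intro i x hx
    have := hsum i x hx
    rw [pd_zero_of_eq hf0 i hx] at this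
    linarith
  -- the radial derivative of `h` vanishes
  have hX : ∀ k : Fin m, Sm (fun x : E m => x k) := fun k =>
    (EuclideanSpace.proj (𝕜 := ℝ) k).contDiff.contDiffOn
  have pX : ∀ k i : Fin m, ∀ x ∈ Ball m, pd i (fun x : E m => x k) x = if k = i then 1 else 0 := by
    intro k i x hx
    have := pd_eq_of_hasFDerivWithinAt hx
      (EuclideanSpace.proj (𝕜 := ℝ) k : E m →L[ℝ] ℝ).hasFDerivAt.hasFDerivWithinAt i
    refine this.trans ?_
    simp [Pi.single_apply]
  have hu : Sm (fun x => ∑ k, x k * pd k h x) := Sm.sum fun k => (hX k).mul (hh.pd k)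
  have pu : ∀ i, ∀ x ∈ Ball m, pd i (fun x => ∑ k, x k * pd k h x) x =
      pd i h x + ∑ k, x k * pd k (pd i h) x := by
    intro i x hx
    rw [pd_sum (fun k => (hX k).mul (hh.pd k)) i hx]
    have : ∀ k, pd i (fun x => x k * pd k h x) x =
        (if k = i then pd k h x else 0) + x k * pd k (pd i h) x := by
      intro k
      rw [pd_mul (hX k) (hh.pd k) i hx, pX k i x hx, pd_comm hh i k hx]
      split_ifs <;> ring
    simp only [this, Finset.sum_add_distrib]
    simp
  have hu0 : ∀ x ∈ Ball m, ∑ k, x k * pd k h x = 0 := by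
    refine hz hu (fun x hx => ?_) fun x hx => ?_
    · have := hwS x hx
      simp only [fun k => hwh k x (Sph_sub_Ball hx), neg_mul, Finset.sum_neg_distrib] at this
      simp only [mul_comm (x _)]
      linarith
    · have h1 : ∀ i, pd i (pd i (fun x => ∑ k, x k * pd k h x)) x =
          pd i (pd i h) x + (pd i (pd i h) x + ∑ k, x k * pd k (pd i (pd i h)) x) := by
        intro i
        have hs : Sm (fun x => ∑ k, x k * pd k (pd i h) x) :=
          Sm.sum fun k => (hX k).mul ((hh.pd i).pd k)
        rw [pd_congr (pu i) i hx, pd_add (hh.pd i) hs i hx,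
          pd_sum (fun k => (hX k).mul ((hh.pd i).pd k)) i hx]
        have : ∀ k, pd i (fun x => x k * pd k (pd i h) x) x =
            (if k = i then pd k (pd i h) x else 0) + x k * pd k (pd i (pd i h)) x := by
          intro k
          rw [pd_mul (hX k) ((hh.pd i).pd k) i hx, pX k i x hx, pd_comm (hh.pd i) i k hx]
          split_ifs <;> ring
        simp only [this, Finset.sum_add_distrib]
        simp
      have h2 : ∀ k, ∑ i, pd k (pd i (pd i h)) x = 0 := by
        intro k
        rw [← pd_sum (fun i => (hh.pd i).pd i) k hx]
        exact pd_zero_of_eq hL k hx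
      have h3 := hL x hx
      simp only [lap] at h3 ⊢
      simp only [h1, Finset.sum_add_distrib, h3]
      rw [Finset.sum_comm]
      simp only [← Finset.mul_sum, h2]
      simp
  have hconst : ∀ x ∈ Ball m, h x = h 0 := by
    intro x hx
    have hmem : ∀ t ∈ Set.Icc (0 : ℝ) 1, t • x ∈ Ball m := by
      intro t ht
      rw [mem_Ball, norm_smul, Real.norm_eq_abs, abs_of_nonneg ht.1]
      exact mul_le_one₀ ht.2 (norm_nonneg _) (mem_Ball.1 hx)
    have hd : ∀ t ∈ Set.Icc (0 : ℝ) 1, HasDerivWithinAt (fun t : ℝ => h (t • x))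
        (fderivWithin ℝ h (Ball m) (t • x) x) (Set.Icc 0 1) t := by
      intro t ht
      have h1 : HasDerivWithinAt (fun t : ℝ => t • x) x (Set.Icc 0 1) t := by
        simpa using ((hasDerivAt_id t).smul_const x).hasDerivWithinAt
      exact (hh.diff (hmem t ht)).comp_hasDerivWithinAt t h1 hmem
    have hzero : ∀ t ∈ Set.Ioo (0 : ℝ) 1, fderivWithin ℝ h (Ball m) (t • x) x = 0 := by
      intro t ht
      have h1 := hu0 (t • x) (hmem t ⟨ht.1.le, ht.2.le⟩)
      have h2 : fderivWithin ℝ h (Ball m) (t • x) x = ∑ k, x k * pd k h (t • x) := by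
        have h3 := congrArg (fderivWithin ℝ h (Ball m) (t • x))
          ((EuclideanSpace.basisFun (Fin m) ℝ).sum_repr x)
        rw [← h3]
        simp [pd, map_sum]
      rw [h2]
      simp only [PiLp.smul_apply, smul_eq_mul, mul_assoc, ← Finset.mul_sum] at h1
      exact (mul_eq_zero.1 h1).resolve_left ht.1.ne'
    obtain ⟨c, hc, hce⟩ := exists_hasDerivAt_eq_slope (fun t : ℝ => h (t • x))
      (fun t => fderivWithin ℝ h (Ball m) (t • x) x) zero_lt_one
      (fun t ht => (hd t ht).continuousWithinAt)
      (fun t ht => (hd t ⟨ht.1.le, ht.2.le⟩).hasDerivAt (Icc_mem_nhds ht.1 ht.2))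
    rw [hzero c hc] at hce
    simp at hce
    linarith
  refine ⟨hf0, ⟨h 0, hconst⟩, fun i x hx => ?_⟩
  rw [hwh i x hx, pd_zero_of_eq hconst i hx, neg_zero]

end final

theorem one_form_decomposition_on_ball
    (m : ℕ) (hm : 2 ≤ m)
    (v : Fin m → E m → ℝ)
    (hv_smooth : ∃ U : Set (E m), IsOpen U ∧ Ball m ⊆ U ∧
      ∀ i, ContDiffOn ℝ (⊤ : ℕ∞) (v i) U) :
    -- existence
    (∃ (f h : E m → ℝ) (w : Fin m → E m → ℝ),
      ContDiffOn ℝ (⊤ : ℕ∞) f (Ball m) ∧ ContDiffOn ℝ (⊤ : ℕ∞) h (Ball m) ∧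
      (∀ i, ContDiffOn ℝ (⊤ : ℕ∞) (w i) (Ball m)) ∧
      (∀ i, ∀ x ∈ Ball m, v i x = pd i f x + pd i h x + w i x) ∧
      (∀ x ∈ Sph m, f x = 0) ∧
      (∀ x ∈ Ball m, lap h x = 0) ∧
      (∀ x ∈ Ball m, ∑ i, pd i (w i) x = 0) ∧
      (∀ x ∈ Sph m, ∑ k, w k x * x k = 0))
    ∧
    -- uniqueness: if the pieces with these side conditions sum to zero,
    -- then f = 0, h is constant and w = 0 on the ball.
    (∀ (f h : E m → ℝ) (w : Fin m → E m → ℝ),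
      ContDiffOn ℝ (⊤ : ℕ∞) f (Ball m) → ContDiffOn ℝ (⊤ : ℕ∞) h (Ball m) →
      (∀ i, ContDiffOn ℝ (⊤ : ℕ∞) (w i) (Ball m)) →
      (∀ x ∈ Sph m, f x = 0) →
      (∀ x ∈ Ball m, lap h x = 0) →
      (∀ x ∈ Ball m, ∑ i, pd i (w i) x = 0) →
      (∀ x ∈ Sph m, ∑ k, w k x * x k = 0) →
      (∀ i, ∀ x ∈ Ball m, pd i f x + pd i h x + w i x = 0) →
      ((∀ x ∈ Ball m, f x = 0) ∧
       (∃ c : ℝ, ∀ x ∈ Ball m, h x = c) ∧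
       (∀ i, ∀ x ∈ Ball m, w i x = 0))) := by
  obtain ⟨U, hU, hB, hv⟩ := hv_smooth
  refine ⟨main_exists hm v hU hB hv, ?_⟩
  intro f h w hf hh hw h1 h2 h3 h4 h5
  exact main_unique hm hf hh hw h1 h2 h3 h4 h5

end
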